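/- arXiv:1503.05252 — 4 statements merged into one kernel-verified Lean document; each statement's English description precedes it below -/
import Mathlib

section
/- The circuit diameter of the realization Ũ₄ = {x ∈ ℝ⁴ : A x ≥ b} of the Klee-Walkup polyhedron equals 4: for every ordered pair of vertices u, v of Ũ₄ there is a circuit walk from u to v of length at most 4, and there exists an ordered pair of vertices u, v admitting no circuit walk from u to v of length at most 3. -/
open Matrix

noncomputable section

/-- The polyhedron `{x ∈ ℝⁿ : A x ≥ b}`. -/
def polySet {m n : ℕ} (A : Matrix (Fin m) (Fin n) ℝ) (b : Fin m → ℝ) : Set (Fin n → ℝ) :=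
  {x | ∀ i, b i ≤ A.mulVec x i}

/-- `g` is a circuit of `A`: `g` is nonzero and the support of `A g` is minimal with respect
to inclusion among the supports of `A v` over all nonzero `v`. -/
def IsCircuit {m n : ℕ} (A : Matrix (Fin m) (Fin n) ℝ) (g : Fin n → ℝ) : Prop :=
  g ≠ 0 ∧ ∀ v : Fin n → ℝ, v ≠ 0 →
    {i | A.mulVec v i ≠ 0} ⊆ {i | A.mulVec g i ≠ 0} →
    {i | A.mulVec v i ≠ 0} = {i | A.mulVec g i ≠ 0}

/-- A circuit walk of length `k` from `u` to `v` in `{x : A x ≥ b}`: a sequence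
`u = y⁰, …, yᵏ = v` of points of the polyhedron where each step is a maximal step
in a circuit direction. -/
def IsCircuitWalk {m n : ℕ} (A : Matrix (Fin m) (Fin n) ℝ) (b : Fin m → ℝ)
    (k : ℕ) (u v : Fin n → ℝ) : Prop :=
  ∃ y : Fin (k + 1) → (Fin n → ℝ),
    y 0 = u ∧ y (Fin.last k) = v ∧ (∀ i, y i ∈ polySet A b) ∧
    ∀ i : Fin k, ∃ g : Fin n → ℝ, ∃ α : ℝ, IsCircuit A g ∧ 0 < α ∧
      y i.succ = y i.castSucc + α • g ∧
      ∀ β : ℝ, α < β → y i.castSucc + β • g ∉ polySet A b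
/-- The constraint matrix of the Klee–Walkup polyhedron realization `Ũ₄`. -/
def kwA : Matrix (Fin 8) (Fin 4) ℝ :=
  !![-6, -3, 0, 1;
     -3, -6, 1, 0;
     -35, -45, 6, 3;
     -45, -35, 3, 6;
     1, 0, 0, 0;
     0, 1, 0, 0;
     0, 0, 1, 0;
     0, 0, 0, 1]

/-- The right-hand side of the Klee–Walkup polyhedron realization `Ũ₄`. -/
def kwb : Fin 8 → ℝ := ![-1, -1, -8, -8, 0, 0, 0, 0]

/-- The integer entries of `kwA`. -/
def kwRow : Fin 8 → Fin 4 → ℤ :=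
  ![![-6, -3, 0, 1], ![-3, -6, 1, 0], ![-35, -45, 6, 3], ![-45, -35, 3, 6],
    ![1, 0, 0, 0], ![0, 1, 0, 0], ![0, 0, 1, 0], ![0, 0, 0, 1]]

/-- The integer product of the `i`-th row of `kwA` with `X`. -/
def kwDot (i : Fin 8) (X : Fin 4 → ℤ) : ℤ :=
  kwRow i 0 * X 0 + kwRow i 1 * X 1 + kwRow i 2 * X 2 + kwRow i 3 * X 3

/-- The vector `-900 • kwb`. -/
def kwOffset : Fin 8 → ℤ := ![900, 900, 7200, 7200, 0, 0, 0, 0]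

/-- `900` times the slack of the `i`-th inequality at the point `X / 900`. -/
def kwSlack (i : Fin 8) (X : Fin 4 → ℤ) : ℤ := kwDot i X + kwOffset i

/-- The point `X / 900`. -/
def kwPoint (X : Fin 4 → ℤ) : Fin 4 → ℝ := fun p => X p / 900

/-- The generalized cross product of three vectors in dimension four. -/
def crossProduct₄ {R : Type*} [CommRing R] (a b c : Fin 4 → R) : Fin 4 → R :=
  ![a 1 * (b 2 * c 3 - b 3 * c 2) - a 2 * (b 1 * c 3 - b 3 * c 1)
      + a 3 * (b 1 * c 2 - b 2 * c 1),
    -(a 0 * (b 2 * c 3 - b 3 * c 2) - a 2 * (b 0 * c 3 - b 3 * c 0)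
      + a 3 * (b 0 * c 2 - b 2 * c 0)),
    a 0 * (b 1 * c 3 - b 3 * c 1) - a 1 * (b 0 * c 3 - b 3 * c 0)
      + a 3 * (b 0 * c 1 - b 1 * c 0),
    -(a 0 * (b 1 * c 2 - b 2 * c 1) - a 1 * (b 0 * c 2 - b 2 * c 0)
      + a 2 * (b 0 * c 1 - b 1 * c 0))]

/-- An integer vector annihilated by the rows `i`, `j`, `k` of `kwA`. -/
def kwNormal (i j k : Fin 8) : Fin 4 → ℤ := crossProduct₄ (kwRow i) (kwRow j) (kwRow k)

/-- The circuits of `kwA` up to scaling. -/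
def kwDirs : List (Fin 4 → ℤ) :=
  [![36, -17, 0, 165], ![33, -15, 0, 160], ![17, -9, 0, 75], ![17, -36, -165, 0],
    ![15, -33, -160, 0], ![12, -6, 0, 55], ![9, 0, 25, 55], ![9, -7, 0, 0], ![9, -17, -75, 0],
    ![7, -9, 0, 0], ![6, 3, 35, 45], ![6, 0, 35, 0], ![6, 0, 17, 36], ![6, -3, 0, 25],
    ![6, -12, -55, 0], ![3, 6, 45, 35], ![3, 0, 9, 17], ![3, 0, 0, 35], ![3, -6, -25, 0],
    ![2, 0, 0, 15], ![2, -1, 0, 9], ![2, -1, 0, 0], ![1, 0, 15, 0], ![1, 0, 3, 6], ![1, 0, 3, 0],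
    ![1, 0, 0, 6], ![1, 0, 0, 0], ![1, -2, 0, 0], ![1, -2, -9, 0], ![0, 9, 55, 25],
    ![0, 6, 36, 17], ![0, 6, 0, 35], ![0, 3, 35, 0], ![0, 3, 17, 9], ![0, 2, 15, 0],
    ![0, 1, 6, 3], ![0, 1, 6, 0], ![0, 1, 0, 15], ![0, 1, 0, 3], ![0, 1, 0, 0], ![0, 0, 2, -1],
    ![0, 0, 1, 0], ![0, 0, 1, -2], ![0, 0, 0, 1]]

/-- The numerators over `900` of the vertices (the first fifteen entries) and of two auxiliary
points on circuit walks between vertices. -/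
def kwNode : Fin 17 → Fin 4 → ℤ :=
  ![![900, 900, 7200, 7200], ![0, 450, 1950, 450], ![0, 300, 1100, 0], ![200, 0, 0, 300],
    ![132, 36, 0, 0], ![150, 0, 0, 0], ![450, 0, 450, 1950], ![0, 200, 300, 0],
    ![300, 0, 0, 1100], ![36, 132, 0, 0], ![0, 150, 0, 0], ![0, 288, 960, 0],
    ![288, 0, 0, 960], ![90, 90, 0, 0], ![0, 0, 0, 0],
    ![0, 0, 1100, 0], ![900, 2000, 13800, 10500]]

/-- Nodes reachable by one circuit step. -/
def kwNext : Fin 17 → List (Fin 17) :=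
  ![[1, 6], [0, 2, 11], [1, 4, 11, 15], [4, 5, 12], [2, 3, 5, 13], [3, 4, 14], [0, 8, 12],
    [9, 10, 11, 16], [6, 9, 12], [7, 8, 10, 13], [7, 9, 14], [1, 2, 7, 13], [3, 6, 8, 13],
    [4, 9, 11, 12], [5, 10], [14], [0]]

/-- Nodes reachable by `k` steps along `kwNext`. -/
def kwReach : ℕ → Fin 17 → List (Fin 17)
  | 0, a => [a]
  | k + 1, a => (kwNext a).flatMap (kwReach k)

/-- The numerators over `900` of the points reachable from `(1, 1, 8, 8)` by one circuit step. -/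
def kwFirst : List (Fin 4 → ℤ) :=
  [![0, 450, 1950, 450], ![0, 900, 4500, 2100], ![0, 900, 4500, 7200], ![0, 900, 4650, 1800],
   ![0, 900, 7200, 1800], ![0, 900, 7200, 7200], ![0, 1325, 7200, 3075],
   ![0, 1350, 7200, 3450], ![0, 1350, 7200, 7200], ![0, 2600, 14700, 7200],
   ![0, 2700, 15450, 7200], ![450, 0, 450, 1950], ![900, 0, 1800, 4650],
   ![900, 0, 1800, 7200], ![900, 0, 2100, 4500], ![900, 0, 7200, 4500],
   ![900, 0, 7200, 7200], ![1325, 0, 3075, 7200], ![1350, 0, 3450, 7200],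
   ![1350, 0, 7200, 7200], ![2600, 0, 7200, 14700], ![2700, 0, 7200, 15450]]

theorem exists_kwDirs_parallel : ∀ i j k : Fin 8, i < j → j < k → ∃ n ∈ kwDirs, ∃ p,
    n p ≠ 0 ∧ kwNormal i j k p ≠ 0 ∧
      ∀ q, kwNormal i j k p * n q = n p * kwNormal i j k q := by
  decide +kernel

theorem kwNode_feasible : ∀ a r, 0 ≤ kwSlack r (kwNode a) := by
  decide +kernel

theorem kwNext_step : ∀ a, ∀ b ∈ kwNext a,
    (∃ i j k : Fin 8, i < j ∧ j < k ∧ kwDot i (kwNode b - kwNode a) = 0 ∧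
      kwDot j (kwNode b - kwNode a) = 0 ∧ kwDot k (kwNode b - kwNode a) = 0) ∧
    ∃ l, 0 < kwSlack l (kwNode a) ∧ kwSlack l (kwNode b) = 0 := by
  decide +kernel

theorem mem_kwReach : ∀ a b : Fin 17, a < 15 → b < 15 → ∃ k : Fin 5, b ∈ kwReach k a := by
  decide +kernel

theorem kwFirst_spec : ∀ n ∈ kwDirs, ∀ l, 0 < kwSlack l (kwNode 0) → kwDot l n ≠ 0 →
    (∀ r, 0 ≤ kwDot l n *
      (kwDot l n * kwSlack r (kwNode 0) - kwSlack l (kwNode 0) * kwDot r n)) →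
    ∃ Y ∈ kwFirst, ∀ p,
      kwDot l n * Y p = kwDot l n * kwNode 0 p - kwSlack l (kwNode 0) * n p := by
  decide +kernel

theorem card_zeros_kwFirst : ∀ Y ∈ kwNode 0 :: kwFirst,
    (Finset.univ.filter fun r => kwDot r Y = 0).card ≤ 2 := by
  decide +kernel

theorem card_zeros_second : ∀ Y ∈ kwFirst, ∀ n ∈ kwDirs, ∀ l,
    0 < kwSlack l Y → kwDot l n ≠ 0 →
    2 < (Finset.univ.filter fun r => kwDot l n * kwDot r Y = kwSlack l Y * kwDot r n).card →
    ∃ r, kwDot l n * (kwDot l n * kwSlack r Y - kwSlack l Y * kwDot r n) < 0 := by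
  decide +kernel

section Generic

variable {m n : ℕ} {A : Matrix (Fin m) (Fin n) ℝ} {b : Fin m → ℝ}

/-- `w` is reached from `u` by a maximal step along a circuit. -/
def IsMaximalCircuitStep (A : Matrix (Fin m) (Fin n) ℝ) (b : Fin m → ℝ)
    (u w : Fin n → ℝ) : Prop :=
  ∃ g : Fin n → ℝ, ∃ α : ℝ, IsCircuit A g ∧ 0 < α ∧ w = u + α • g ∧
    ∀ β : ℝ, α < β → u + β • g ∉ polySet A b

theorem isCircuitWalk_zero_iff {u v : Fin n → ℝ} :
    IsCircuitWalk A b 0 u v ↔ u ∈ polySet A b ∧ u = v := by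
  constructor
  · rintro ⟨y, rfl, rfl, hy, -⟩
    exact ⟨hy 0, rfl⟩
  · rintro ⟨hu, rfl⟩
    exact ⟨fun _ => u, rfl, rfl, fun _ => hu, fun i => i.elim0⟩

theorem isCircuitWalk_succ_iff {k : ℕ} {u v : Fin n → ℝ} :
    IsCircuitWalk A b (k + 1) u v ↔
      u ∈ polySet A b ∧ ∃ w, IsMaximalCircuitStep A b u w ∧ IsCircuitWalk A b k w v := by
  constructor
  · rintro ⟨y, rfl, rfl, hy, hstep⟩
    exact ⟨hy 0, y 1, hstep 0, fun i => y i.succ, rfl, rfl, fun i => hy _,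
      fun i => hstep i.succ⟩
  · rintro ⟨hu, w, hw, y, rfl, rfl, hy, hstep⟩
    refine ⟨Fin.cons u y, rfl, by rw [← Fin.succ_last, Fin.cons_succ],
      Fin.cases hu hy, Fin.cases ?_ fun i => ?_⟩
    · exact hw
    · exact hstep i

theorem IsCircuitWalk.left_mem {k : ℕ} {u v : Fin n → ℝ} (h : IsCircuitWalk A b k u v) :
    u ∈ polySet A b := by
  obtain ⟨y, rfl, -, hy, -⟩ := h
  exact hy 0

theorem eventually_add_smul_mem_polySet {x d : Fin n → ℝ} (hx : x ∈ polySet A b)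
    (hd : ∀ i, A.mulVec x i = b i → 0 ≤ A.mulVec d i) :
    ∀ᶠ ε in nhdsWithin (0 : ℝ) (Set.Ioi 0), x + ε • d ∈ polySet A b := by
  have key : ∀ᶠ ε in nhdsWithin (0 : ℝ) (Set.Ioi 0),
      ∀ i, b i ≤ A.mulVec x i + ε * A.mulVec d i := by
    rw [Filter.eventually_all]
    intro i
    rcases (hx i).eq_or_lt with h | h
    · filter_upwards [self_mem_nhdsWithin] with ε hε
      have := mul_nonneg (le_of_lt (Set.mem_Ioi.1 hε)) (hd i h.symm)
      linarith
    · have hc : Filter.Tendsto (fun ε : ℝ => A.mulVec x i + ε * A.mulVec d i) (nhds 0)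
          (nhds (A.mulVec x i + 0 * A.mulVec d i)) :=
        Continuous.tendsto (by fun_prop) 0
      have := hc.eventually_const_lt (u := b i) (by simpa using h)
      exact (this.filter_mono nhdsWithin_le_nhds).mono fun _ => le_of_lt
  filter_upwards [key] with ε hε i
  simpa [Matrix.mulVec_add, Matrix.mulVec_smul] using hε i

theorem IsCircuit.smul {g : Fin n → ℝ} (hg : IsCircuit A g) {c : ℝ} (hc : c ≠ 0) :
    IsCircuit A (c • g) := by
  have hsupp : {i | A.mulVec (c • g) i ≠ 0} = {i | A.mulVec g i ≠ 0} := by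
    ext i
    simp [Matrix.mulVec_smul, hc]
  exact ⟨smul_ne_zero hc hg.1, by simpa only [hsupp] using hg.2⟩

/-- A maximal step is stopped by an inequality that becomes tight. -/
theorem isMaximalCircuitStep_iff {u w : Fin n → ℝ} (hw : w ∈ polySet A b) :
    IsMaximalCircuitStep A b u w ↔
      IsCircuit A (w - u) ∧ ∃ i, b i < A.mulVec u i ∧ A.mulVec w i = b i := by
  constructor
  · rintro ⟨g, α, hg, hα, rfl, hmax⟩
    refine ⟨by simpa using hg.smul hα.ne', ?_⟩
    by_contra! hcon
    have hev := eventually_add_smul_mem_polySet (d := g) hw fun i hi => by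
      have hui : A.mulVec u i ≤ b i := not_lt.1 fun hlt => hcon i hlt hi
      have hsum : A.mulVec u i + α * A.mulVec g i = b i := by
        simpa [Matrix.mulVec_add, Matrix.mulVec_smul] using hi
      exact nonneg_of_mul_nonneg_right (by linarith : 0 ≤ α * A.mulVec g i) hα
    obtain ⟨ε, hmem, hε⟩ := (hev.and self_mem_nhdsWithin).exists
    have hε : 0 < ε := hε
    refine hmax (α + ε) (by linarith) ?_
    rwa [add_smul, ← add_assoc]
  · rintro ⟨hg, i, hui, hwi⟩
    refine ⟨w - u, 1, hg, one_pos, by simp, fun β hβ hmem => ?_⟩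
    have h := hmem i
    simp only [Matrix.mulVec_add, Matrix.mulVec_smul, Matrix.mulVec_sub, Pi.add_apply,
      Pi.smul_apply, Pi.sub_apply, smul_eq_mul, hwi] at h
    nlinarith

theorem eq_of_mem_extremePoints {x v : Fin n → ℝ}
    (hx : x ∈ Set.extremePoints ℝ (polySet A b)) (hv : v ∈ polySet A b)
    (h : ∀ i, A.mulVec x i = b i → A.mulVec v i = b i) : x = v := by
  have hev := eventually_add_smul_mem_polySet (d := x - v) hx.1 fun i hi => by
    simp [Matrix.mulVec_sub, hi, h i hi]
  obtain ⟨ε, hmem, hε⟩ := (hev.and self_mem_nhdsWithin).exists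
  have hε : 0 < ε := hε
  refine (hx.2 hv hmem ⟨ε / (1 + ε), 1 / (1 + ε), by positivity, by positivity,
    by field_simp; ring, ?_⟩).symm
  ext p
  simp only [Pi.add_apply, Pi.smul_apply, Pi.sub_apply, smul_eq_mul]
  field_simp
  ring

theorem mem_extremePoints_polySet {x : Fin n → ℝ} (hx : x ∈ polySet A b)
    (h : ∀ y ∈ polySet A b, (∀ i, A.mulVec x i = b i → A.mulVec y i = b i) → y = x) :
    x ∈ Set.extremePoints ℝ (polySet A b) := by
  refine ⟨hx, fun y hy z hz ⟨s, t, hs, ht, hst, hxyz⟩ => h y hy fun i hi => ?_⟩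
  have hi' : s * A.mulVec y i + t * A.mulVec z i = b i := by
    rw [← hi, ← hxyz]
    simp [Matrix.mulVec_add, Matrix.mulVec_smul]
  have hy' := hy i
  have hz' := hz i
  have : t * b i ≤ t * A.mulVec z i := by gcongr
  have : s * A.mulVec y i ≤ s * b i := by
    have : s * b i + t * b i = b i := by rw [← add_mul, hst, one_mul]
    linarith
  exact le_antisymm (le_of_mul_le_mul_left this hs) hy'

end Generic

theorem kwA_mulVec (x : Fin 4 → ℝ) (i : Fin 8) :
    kwA.mulVec x i =
      kwRow i 0 * x 0 + kwRow i 1 * x 1 + kwRow i 2 * x 2 + kwRow i 3 * x 3 := by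
  fin_cases i <;> simp [kwA, kwRow, Matrix.mulVec, dotProduct, Fin.sum_univ_four]

theorem kwA_mulVec_intCast (X : Fin 4 → ℤ) (i : Fin 8) :
    kwA.mulVec (fun p => (X p : ℝ)) i = kwDot i X := by
  simp [kwA_mulVec, kwDot]

theorem kwA_mulVec_kwPoint (X : Fin 4 → ℤ) (i : Fin 8) :
    900 * kwA.mulVec (kwPoint X) i = kwDot i X := by
  simp only [kwA_mulVec, kwDot, kwPoint]
  push_cast
  ring

theorem cast_kwOffset (i : Fin 8) : (kwOffset i : ℝ) = -900 * kwb i := by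
  fin_cases i <;> norm_num [kwOffset, kwb]

theorem cast_kwSlack (X : Fin 4 → ℤ) (i : Fin 8) :
    (kwSlack i X : ℝ) = 900 * (kwA.mulVec (kwPoint X) i - kwb i) := by
  rw [kwSlack, Int.cast_add, cast_kwOffset, ← kwA_mulVec_kwPoint]
  ring

theorem eq_zero_of_kwA_mulVec_eq_zero {x : Fin 4 → ℝ} (h : ∀ i, kwA.mulVec x i = 0) :
    x = 0 := by
  have h4 := h 4
  have h5 := h 5
  have h6 := h 6
  have h7 := h 7
  simp [kwA_mulVec, kwRow] at h4 h5 h6 h7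
  ext p
  fin_cases p <;> assumption

theorem kwDot_kwNormal : ∀ i j k : Fin 8, kwDot i (kwNormal i j k) = 0 ∧
    kwDot j (kwNormal i j k) = 0 ∧ kwDot k (kwNormal i j k) = 0 := by
  intro i j k
  refine ⟨?_, ?_, ?_⟩ <;> simp [kwDot, kwNormal, crossProduct₄] <;> ring

/-- A vector orthogonal to three vectors in dimension four is parallel to their cross product. -/
theorem crossProduct₄_mul_comm {R : Type*} [CommRing R] {a b c g : Fin 4 → R}
    (ha : a 0 * g 0 + a 1 * g 1 + a 2 * g 2 + a 3 * g 3 = 0)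
    (hb : b 0 * g 0 + b 1 * g 1 + b 2 * g 2 + b 3 * g 3 = 0)
    (hc : c 0 * g 0 + c 1 * g 1 + c 2 * g 2 + c 3 * g 3 = 0) (p q : Fin 4) :
    crossProduct₄ a b c p * g q = crossProduct₄ a b c q * g p := by
  have h01 : crossProduct₄ a b c 0 * g 1 = crossProduct₄ a b c 1 * g 0 := by
    simp only [crossProduct₄, Matrix.cons_val]
    linear_combination (b 2 * c 3 - b 3 * c 2) * ha - (a 2 * c 3 - a 3 * c 2) * hb +
      (a 2 * b 3 - a 3 * b 2) * hc
  have h02 : crossProduct₄ a b c 0 * g 2 = crossProduct₄ a b c 2 * g 0 := by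
    simp only [crossProduct₄, Matrix.cons_val]
    linear_combination -(b 1 * c 3 - b 3 * c 1) * ha + (a 1 * c 3 - a 3 * c 1) * hb -
      (a 1 * b 3 - a 3 * b 1) * hc
  have h03 : crossProduct₄ a b c 0 * g 3 = crossProduct₄ a b c 3 * g 0 := by
    simp only [crossProduct₄, Matrix.cons_val]
    linear_combination (b 1 * c 2 - b 2 * c 1) * ha - (a 1 * c 2 - a 2 * c 1) * hb +
      (a 1 * b 2 - a 2 * b 1) * hc
  have h12 : crossProduct₄ a b c 1 * g 2 = crossProduct₄ a b c 2 * g 1 := by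
    simp only [crossProduct₄, Matrix.cons_val]
    linear_combination (b 0 * c 3 - b 3 * c 0) * ha - (a 0 * c 3 - a 3 * c 0) * hb +
      (a 0 * b 3 - a 3 * b 0) * hc
  have h13 : crossProduct₄ a b c 1 * g 3 = crossProduct₄ a b c 3 * g 1 := by
    simp only [crossProduct₄, Matrix.cons_val]
    linear_combination -(b 0 * c 2 - b 2 * c 0) * ha + (a 0 * c 2 - a 2 * c 0) * hb -
      (a 0 * b 2 - a 2 * b 0) * hc
  have h23 : crossProduct₄ a b c 2 * g 3 = crossProduct₄ a b c 3 * g 2 := by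
    simp only [crossProduct₄, Matrix.cons_val]
    linear_combination (b 0 * c 1 - b 1 * c 0) * ha - (a 0 * c 1 - a 1 * c 0) * hb +
      (a 0 * b 1 - a 1 * b 0) * hc
  fin_cases p <;> fin_cases q <;> first | rfl | assumption | (symm; assumption)

/-- The kernel of three rows of `kwA` is spanned by an element of `kwDirs`. -/
theorem exists_kwDirs_smul {i j k : Fin 8} (hij : i < j) (hjk : j < k) :
    ∃ n ∈ kwDirs, ∀ g : Fin 4 → ℝ, kwA.mulVec g i = 0 → kwA.mulVec g j = 0 →
      kwA.mulVec g k = 0 → ∃ t : ℝ, g = t • fun q => (n q : ℝ) := by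
  obtain ⟨n, hn, p, hnp, hNp, hpar⟩ := exists_kwDirs_parallel i j k hij hjk
  refine ⟨n, hn, fun g hi hj hk => ⟨g p / n p, funext fun q => ?_⟩⟩
  rw [kwA_mulVec] at hi hj hk
  have hcross := crossProduct₄_mul_comm (a := fun s => (kwRow i s : ℝ))
    (b := fun s => (kwRow j s : ℝ)) (c := fun s => (kwRow k s : ℝ)) hi hj hk p q
  have hcast : ∀ s, crossProduct₄ (fun s => (kwRow i s : ℝ)) (fun s => (kwRow j s : ℝ))
      (fun s => (kwRow k s : ℝ)) s = kwNormal i j k s := by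
    intro s
    fin_cases s <;> simp [kwNormal, crossProduct₄]
  rw [hcast, hcast] at hcross
  have hpar' : (kwNormal i j k p : ℝ) * n q = n p * kwNormal i j k q := by
    exact_mod_cast hpar q
  have hnp' : (n p : ℝ) ≠ 0 := by exact_mod_cast hnp
  have hNp' : (kwNormal i j k p : ℝ) ≠ 0 := by exact_mod_cast hNp
  rw [Pi.smul_apply, smul_eq_mul, div_mul_eq_mul_div, eq_div_iff hnp']
  apply mul_left_cancel₀ hNp'
  linear_combination (n p : ℝ) * hcross - g p * hpar'

theorem exists_eq_of_card_eq_three {α : Type*} [LinearOrder α] {s : Finset α}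
    (hs : s.card = 3) : ∃ i j k, i < j ∧ j < k ∧ s = {i, j, k} := by
  refine ⟨s.orderEmbOfFin hs 0, s.orderEmbOfFin hs 1, s.orderEmbOfFin hs 2, by simp, by simp,
    (Finset.image_orderEmbOfFin_univ s hs).symm.trans ?_⟩
  rw [show (Finset.univ : Finset (Fin 3)) = {0, 1, 2} from rfl]
  simp only [Finset.image_insert, Finset.image_singleton]

theorem isCircuit_kwA_iff {g : Fin 4 → ℝ} :
    IsCircuit kwA g ↔ g ≠ 0 ∧ ∃ i j k : Fin 8, i < j ∧ j < k ∧
      kwA.mulVec g i = 0 ∧ kwA.mulVec g j = 0 ∧ kwA.mulVec g k = 0 := by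
  constructor
  · rintro ⟨hg, hmin⟩
    refine ⟨hg, ?_⟩
    obtain ⟨l, hl⟩ : ∃ l, kwA.mulVec g l ≠ 0 := by
      by_contra! h
      exact hg (eq_zero_of_kwA_mulVec_eq_zero h)
    set Z : Finset (Fin 8) := Finset.univ.filter fun r => kwA.mulVec g r = 0 with hZ
    rcases le_or_gt 3 Z.card with hcard | hcard
    · obtain ⟨s, hsZ, hs⟩ := Finset.exists_subset_card_eq hcard
      obtain ⟨i, j, k, hij, hjk, rfl⟩ := exists_eq_of_card_eq_three hs
      refine ⟨i, j, k, hij, hjk, ?_⟩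
      simpa [hZ, Finset.insert_subset_iff] using hsZ
    · obtain ⟨s, hsZ, -, hs⟩ := Finset.exists_subsuperset_card_eq (n := 3)
        (Finset.subset_univ (insert l Z)) (by
          have := Finset.card_insert_le l Z
          omega) (by simp)
      obtain ⟨i, j, k, hij, hjk, rfl⟩ := exists_eq_of_card_eq_three hs
      obtain ⟨-, -, p, -, hp, -⟩ := exists_kwDirs_parallel i j k hij hjk
      have hzero : ∀ r ∈ ({i, j, k} : Finset (Fin 8)),
          kwA.mulVec (fun p => (kwNormal i j k p : ℝ)) r = 0 := by
        intro r hr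
        rw [kwA_mulVec_intCast, Int.cast_eq_zero]
        obtain ⟨h1, h2, h3⟩ := kwDot_kwNormal i j k
        simp only [Finset.mem_insert, Finset.mem_singleton] at hr
        rcases hr with rfl | rfl | rfl <;> assumption
      have heq := hmin (fun p => (kwNormal i j k p : ℝ))
        (fun h => hp (by simpa using congrFun h p)) (fun r hr hgr =>
          hr (hzero r (hsZ (Finset.mem_insert_of_mem (by simp [hZ, hgr])))))
      have hl' : l ∈ {r | kwA.mulVec g r ≠ 0} := hl
      rw [← heq] at hl'
      exact (hl' (hzero l (hsZ (Finset.mem_insert_self _ _)))).elim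
  · rintro ⟨hg, i, j, k, hij, hjk, hi, hj, hk⟩
    refine ⟨hg, fun v hv hsub => hsub.antisymm fun r hgr hvr => ?_⟩
    have hv0 : ∀ {r}, kwA.mulVec g r = 0 → kwA.mulVec v r = 0 := fun hr =>
      not_not.1 fun h => hsub h hr
    obtain ⟨n, -, hn⟩ := exists_kwDirs_smul hij hjk
    obtain ⟨t, rfl⟩ := hn v (hv0 hi) (hv0 hj) (hv0 hk)
    obtain ⟨s, rfl⟩ := hn g hi hj hk
    have ht : t ≠ 0 := fun h => hv (by simp [h])
    refine hgr ?_
    rw [Matrix.mulVec_smul, Pi.smul_apply, smul_eq_mul, mul_eq_zero] at hvr ⊢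
    exact Or.inr (hvr.resolve_left ht)

theorem kwPoint_mem_iff {X : Fin 4 → ℤ} :
    kwPoint X ∈ polySet kwA kwb ↔ ∀ r, 0 ≤ kwSlack r X := by
  refine forall_congr' fun r => ?_
  rw [← Int.cast_nonneg_iff (R := ℝ), cast_kwSlack]
  constructor <;> intro h <;> linarith

theorem kwPoint_sub (X Y : Fin 4 → ℤ) : kwPoint X - kwPoint Y = kwPoint (X - Y) := by
  ext p
  simp [kwPoint, sub_div]

theorem kwA_mulVec_kwPoint_eq_zero_iff {X : Fin 4 → ℤ} {i : Fin 8} :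
    kwA.mulVec (kwPoint X) i = 0 ↔ kwDot i X = 0 := by
  rw [← Int.cast_eq_zero (α := ℝ), ← kwA_mulVec_kwPoint]
  simp

theorem isMaximalCircuitStep_of_mem_kwNext {a c : Fin 17} (h : c ∈ kwNext a) :
    IsMaximalCircuitStep kwA kwb (kwPoint (kwNode a)) (kwPoint (kwNode c)) := by
  obtain ⟨⟨i, j, k, hij, hjk, hi, hj, hk⟩, l, hla, hlc⟩ := kwNext_step a c h
  rw [isMaximalCircuitStep_iff (kwPoint_mem_iff.2 (kwNode_feasible c)), isCircuit_kwA_iff,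
    kwPoint_sub]
  rw [← Int.cast_pos (R := ℝ), cast_kwSlack] at hla
  rw [← Int.cast_eq_zero (α := ℝ), cast_kwSlack] at hlc
  refine ⟨⟨fun h0 => ?_, i, j, k, hij, hjk, kwA_mulVec_kwPoint_eq_zero_iff.2 hi,
    kwA_mulVec_kwPoint_eq_zero_iff.2 hj, kwA_mulVec_kwPoint_eq_zero_iff.2 hk⟩,
    l, by linarith, by linarith⟩
  rw [← kwPoint_sub, sub_eq_zero] at h0
  rw [h0] at hlc
  linarith

theorem isCircuitWalk_of_mem_kwReach {k : ℕ} {a c : Fin 17} (h : c ∈ kwReach k a) :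
    IsCircuitWalk kwA kwb k (kwPoint (kwNode a)) (kwPoint (kwNode c)) := by
  induction k generalizing a with
  | zero =>
    rw [kwReach, List.mem_singleton] at h
    subst h
    exact isCircuitWalk_zero_iff.2 ⟨kwPoint_mem_iff.2 (kwNode_feasible _), rfl⟩
  | succ k ih =>
    obtain ⟨d, hd, hc⟩ := List.mem_flatMap.1 h
    exact isCircuitWalk_succ_iff.2 ⟨kwPoint_mem_iff.2 (kwNode_feasible a), _,
      isMaximalCircuitStep_of_mem_kwNext hd, ih hc⟩

/-- The minimal sets of inequalities which are not simultaneously tight on `polySet kwA kwb`. -/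
def kwNonfaces : List (Fin 8 × Fin 8 × Fin 8) :=
  [(0, 1, 4), (0, 1, 5), (0, 1, 6), (0, 1, 7), (0, 2, 5), (0, 2, 6), (0, 2, 7), (0, 4, 5),
    (0, 4, 6), (1, 3, 4), (1, 3, 6), (1, 3, 7), (1, 4, 5), (1, 5, 7), (2, 4, 5), (2, 4, 6),
    (2, 5, 7), (3, 4, 5), (3, 4, 6), (3, 5, 7)]

theorem not_tight_of_mem_kwNonfaces {x : Fin 4 → ℝ} (hx : x ∈ polySet kwA kwb)
    {t : Fin 8 × Fin 8 × Fin 8} (ht : t ∈ kwNonfaces) :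
    ¬(kwA.mulVec x t.1 = kwb t.1 ∧ kwA.mulVec x t.2.1 = kwb t.2.1 ∧
      kwA.mulVec x t.2.2 = kwb t.2.2) := by
  have h : ∀ i, kwb i ≤ kwA.mulVec x i := hx
  simp only [kwA_mulVec, Fin.forall_fin_succ] at h
  simp [kwRow, kwb] at h
  obtain ⟨h0, h1, h2, h3, h4, h5, h6, h7⟩ := h
  simp only [kwNonfaces, List.mem_cons, List.not_mem_nil, or_false] at ht
  rintro ⟨e1, e2, e3⟩
  rw [kwA_mulVec] at e1 e2 e3
  rcases ht with rfl | rfl | rfl | rfl | rfl | rfl | rfl | rfl | rfl | rfl | rfl | rfl | rfl |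
    rfl | rfl | rfl | rfl | rfl | rfl | rfl <;>
  · simp [kwRow, kwb] at e1 e2 e3
    linarith

theorem exists_kwNode_of_kwNonfaces : ∀ s : Finset (Fin 8),
    (∀ t ∈ kwNonfaces, ¬(t.1 ∈ s ∧ t.2.1 ∈ s ∧ t.2.2 ∈ s)) →
    ∃ c : Fin 17, c < 15 ∧ ∀ i ∈ s, kwSlack i (kwNode c) = 0 := by
  decide +kernel

theorem exists_kwNode_of_mem_extremePoints {x : Fin 4 → ℝ}
    (hx : x ∈ Set.extremePoints ℝ (polySet kwA kwb)) :
    ∃ c : Fin 17, c < 15 ∧ x = kwPoint (kwNode c) := by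
  classical
  have hfaces :=
    exists_kwNode_of_kwNonfaces (Finset.univ.filter fun i => kwA.mulVec x i = kwb i)
  simp only [Finset.mem_filter_univ] at hfaces
  obtain ⟨c, hc, htight⟩ := hfaces fun t ht => not_tight_of_mem_kwNonfaces hx.1 ht
  refine ⟨c, hc, eq_of_mem_extremePoints hx (kwPoint_mem_iff.2 (kwNode_feasible c))
    fun i hi => ?_⟩
  have := htight i hi
  rw [← Int.cast_eq_zero (α := ℝ), cast_kwSlack] at this
  linarith

/-- A circuit step from `X / 900` in integer form. -/
theorem exists_of_isMaximalCircuitStep {X : Fin 4 → ℤ} {w : Fin 4 → ℝ}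
    (hw : w ∈ polySet kwA kwb) (h : IsMaximalCircuitStep kwA kwb (kwPoint X) w) :
    ∃ n ∈ kwDirs, ∃ l, 0 < kwSlack l X ∧ kwDot l n ≠ 0 ∧
      (∀ p, 900 * kwDot l n * w p = kwDot l n * X p - kwSlack l X * n p) ∧
      (∀ r, 0 ≤ kwDot l n * (kwDot l n * kwSlack r X - kwSlack l X * kwDot r n)) := by
  rw [isMaximalCircuitStep_iff hw, isCircuit_kwA_iff] at h
  obtain ⟨⟨-, i, j, k, hij, hjk, hi, hj, hk⟩, l, hl, hwl⟩ := h
  obtain ⟨n, hn, hspan⟩ := exists_kwDirs_smul hij hjk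
  obtain ⟨t, ht⟩ := hspan _ hi hj hk
  obtain rfl : w = kwPoint X + t • fun q => (n q : ℝ) := by rw [← ht]; abel
  have hA : ∀ r, kwA.mulVec (kwPoint X + t • fun q => (n q : ℝ)) r =
      kwA.mulVec (kwPoint X) r + t * kwDot r n := fun r => by
    rw [Matrix.mulVec_add, Matrix.mulVec_smul, Pi.add_apply, Pi.smul_apply,
      kwA_mulVec_intCast, smul_eq_mul]
  rw [hA] at hwl
  have hS := cast_kwSlack X l
  have htl : 900 * t * kwDot l n = -kwSlack l X := by linarith
  refine ⟨n, hn, l, ?_, fun h0 => ?_, fun p => ?_, fun r => ?_⟩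
  · rw [← Int.cast_pos (R := ℝ), hS]
    linarith
  · rw [h0, Int.cast_zero] at hwl
    linarith
  · simp only [Pi.add_apply, Pi.smul_apply, smul_eq_mul, kwPoint]
    linear_combination (n p : ℝ) * htl
  · rw [← Int.cast_nonneg_iff (R := ℝ)]
    push_cast
    have hr := hw r
    rw [hA] at hr
    have hSr := cast_kwSlack X r
    have : (kwDot l n : ℝ) * (kwDot l n * kwSlack r X - kwSlack l X * kwDot r n) =
        (kwDot l n : ℝ) ^ 2 *
          (900 * (kwA.mulVec (kwPoint X) r + t * kwDot r n - kwb r)) := by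
      linear_combination (kwDot l n : ℝ) ^ 2 * hSr - kwDot l n * kwDot r n * htl
    rw [this]
    exact mul_nonneg (sq_nonneg _) (by linarith)

theorem kwPoint_kwNode_fourteen : kwPoint (kwNode 14) = 0 := by
  ext p
  fin_cases p <;> simp [kwPoint, kwNode]

/-- A last step to the origin starts at a point annihilated by three rows of `kwA`. -/
theorem two_lt_card_zeros {w : Fin 4 → ℝ} (h : IsMaximalCircuitStep kwA kwb w 0) :
    2 < (Finset.univ.filter fun r => kwA.mulVec w r = 0).card := by
  have h0 : (0 : Fin 4 → ℝ) ∈ polySet kwA kwb :=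
    kwPoint_kwNode_fourteen ▸ kwPoint_mem_iff.2 (kwNode_feasible 14)
  rw [isMaximalCircuitStep_iff h0, isCircuit_kwA_iff] at h
  obtain ⟨⟨-, i, j, k, hij, hjk, hi, hj, hk⟩, -⟩ := h
  rw [zero_sub, Matrix.mulVec_neg, Pi.neg_apply, neg_eq_zero] at hi hj hk
  exact Finset.two_lt_card.2 ⟨i, by simpa, j, by simpa, k, by simpa, hij.ne,
    (hij.trans hjk).ne, hjk.ne⟩

theorem not_step_zero {Y : Fin 4 → ℤ} (hY : Y ∈ kwNode 0 :: kwFirst) :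
    ¬IsMaximalCircuitStep kwA kwb (kwPoint Y) 0 := by
  intro h
  have := two_lt_card_zeros h
  simp only [kwA_mulVec_kwPoint_eq_zero_iff] at this
  exact absurd (card_zeros_kwFirst Y hY) (not_le.2 this)

theorem exists_kwFirst_of_step {w : Fin 4 → ℝ} (hw : w ∈ polySet kwA kwb)
    (h : IsMaximalCircuitStep kwA kwb (kwPoint (kwNode 0)) w) :
    ∃ Y ∈ kwFirst, w = kwPoint Y := by
  obtain ⟨n, hn, l, hl, hm, hwp, hfeas⟩ := exists_of_isMaximalCircuitStep hw h
  obtain ⟨Y, hY, hYp⟩ := kwFirst_spec n hn l hl hm hfeas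
  refine ⟨Y, hY, funext fun p => ?_⟩
  have hm' : (kwDot l n : ℝ) ≠ 0 := by exact_mod_cast hm
  have hYp' : (kwDot l n : ℝ) * Y p = kwDot l n * kwNode 0 p - kwSlack l (kwNode 0) * n p := by
    exact_mod_cast hYp p
  rw [kwPoint, eq_div_iff (by norm_num)]
  apply mul_left_cancel₀ hm'
  linear_combination hwp p - hYp'

theorem not_step_step_zero {Y : Fin 4 → ℤ} (hY : Y ∈ kwFirst) {w : Fin 4 → ℝ}
    (hw : w ∈ polySet kwA kwb) (h : IsMaximalCircuitStep kwA kwb (kwPoint Y) w) :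
    ¬IsMaximalCircuitStep kwA kwb w 0 := by
  intro h'
  obtain ⟨n, hn, l, hl, hm, hwp, hfeas⟩ := exists_of_isMaximalCircuitStep hw h
  have hm' : (kwDot l n : ℝ) ≠ 0 := by exact_mod_cast hm
  have hcard := two_lt_card_zeros h'
  have hiff : ∀ r, kwA.mulVec w r = 0 ↔ kwDot l n * kwDot r Y = kwSlack l Y * kwDot r n := by
    intro r
    have hAw : 900 * kwDot l n * kwA.mulVec w r =
        kwDot l n * kwDot r Y - kwSlack l Y * kwDot r n := by
      rw [kwA_mulVec]
      simp only [kwDot] at hwp ⊢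
      push_cast at hwp ⊢
      linear_combination (kwRow r 0 : ℝ) * hwp 0 + kwRow r 1 * hwp 1 + kwRow r 2 * hwp 2 +
        kwRow r 3 * hwp 3
    rw [← Int.cast_inj (α := ℝ)]
    push_cast
    rw [← sub_eq_zero (a := (kwDot l n : ℝ) * _), ← hAw]
    simp [hm']
  simp only [hiff] at hcard
  obtain ⟨r, hr⟩ := card_zeros_second Y hY n hn l hl hm hcard
  exact absurd (hfeas r) (not_le.2 hr)

theorem not_isCircuitWalk_of_le_three {k : ℕ} (hk : k ≤ 3) :
    ¬IsCircuitWalk kwA kwb k (kwPoint (kwNode 0)) 0 := by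
  intro h
  rcases k with _ | k
  · have := congrFun (isCircuitWalk_zero_iff.1 h).2 0
    norm_num [kwPoint, kwNode] at this
  obtain ⟨-, w, hstep, h⟩ := isCircuitWalk_succ_iff.1 h
  rcases k with _ | k
  · obtain ⟨-, rfl⟩ := isCircuitWalk_zero_iff.1 h
    exact not_step_zero List.mem_cons_self hstep
  obtain ⟨Y, hY, rfl⟩ := exists_kwFirst_of_step h.left_mem hstep
  obtain ⟨-, w, hstep, h⟩ := isCircuitWalk_succ_iff.1 h
  rcases k with _ | k
  · obtain ⟨-, rfl⟩ := isCircuitWalk_zero_iff.1 h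
    exact not_step_zero (List.mem_cons_of_mem _ hY) hstep
  obtain ⟨-, w', hstep', h'⟩ := isCircuitWalk_succ_iff.1 h
  obtain rfl : k = 0 := by omega
  obtain ⟨-, rfl⟩ := isCircuitWalk_zero_iff.1 h'
  exact not_step_step_zero hY h.left_mem hstep hstep'

theorem kwPoint_kwNode_zero_mem_extremePoints :
    kwPoint (kwNode 0) ∈ Set.extremePoints ℝ (polySet kwA kwb) := by
  refine mem_extremePoints_polySet (kwPoint_mem_iff.2 (kwNode_feasible 0)) fun y _ h => ?_
  have hslack : ∀ i, kwSlack i (kwNode 0) = 0 → kwA.mulVec y i = kwb i := fun i hi => h i <| by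
    rw [← Int.cast_eq_zero (α := ℝ), cast_kwSlack] at hi
    linarith
  have h0 := hslack 0 (by decide)
  have h1 := hslack 1 (by decide)
  have h2 := hslack 2 (by decide)
  have h3 := hslack 3 (by decide)
  rw [kwA_mulVec] at h0 h1 h2 h3
  simp [kwRow, kwb] at h0 h1 h2 h3
  ext p
  fin_cases p <;> simp [kwPoint, kwNode] <;> linarith

theorem zero_mem_extremePoints :
    (0 : Fin 4 → ℝ) ∈ Set.extremePoints ℝ (polySet kwA kwb) := by
  refine mem_extremePoints_polySet
    (kwPoint_kwNode_fourteen ▸ kwPoint_mem_iff.2 (kwNode_feasible 14)) fun y _ h => ?_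
  have h4 := h 4
  have h5 := h 5
  have h6 := h 6
  have h7 := h 7
  simp [kwA_mulVec, kwRow, kwb] at h4 h5 h6 h7
  ext p
  fin_cases p <;> assumption

/-- The circuit diameter of the realization `Ũ₄` of the Klee–Walkup polyhedron equals 4:
every ordered pair of vertices is joined by a circuit walk of length at most 4, and some
ordered pair of vertices admits no circuit walk of length at most 3. -/
theorem kw_circuit_diameter_eq_four :
    (∀ u v : Fin 4 → ℝ, u ∈ Set.extremePoints ℝ (polySet kwA kwb) →
      v ∈ Set.extremePoints ℝ (polySet kwA kwb) →
      ∃ k ≤ 4, IsCircuitWalk kwA kwb k u v) ∧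
    (∃ u v : Fin 4 → ℝ, u ∈ Set.extremePoints ℝ (polySet kwA kwb) ∧
      v ∈ Set.extremePoints ℝ (polySet kwA kwb) ∧
      ∀ k ≤ 3, ¬ IsCircuitWalk kwA kwb k u v) := by
  refine ⟨fun u v hu hv => ?_, kwPoint (kwNode 0), 0, kwPoint_kwNode_zero_mem_extremePoints,
    zero_mem_extremePoints, fun k hk => not_isCircuitWalk_of_le_three hk⟩
  obtain ⟨a, ha, rfl⟩ := exists_kwNode_of_mem_extremePoints hu
  obtain ⟨c, hc, rfl⟩ := exists_kwNode_of_mem_extremePoints hv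
  obtain ⟨k, hk⟩ := mem_kwReach a c ha hc
  exact ⟨k, Nat.le_of_lt_succ k.isLt, isCircuitWalk_of_mem_kwReach hk⟩
end
end

section
/- The circuit diameter of the realization Q̃₄ = {x ∈ ℝ⁴ : A_Q x ≥ b_Q} of the Klee-Walkup polytope equals 3: for every ordered pair of vertices u, v of Q̃₄ there is a circuit walk from u to v of length at most 3, and there exists an ordered pair of vertices admitting no circuit walk of length at most 2. -/
open Matrix

noncomputable section

/-- The constraint matrix of the Klee–Walkup polytope realization `Q̃₄`. -/
def AQ : Matrix (Fin 9) (Fin 4) ℝ :=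
  !![3, -3, -1, -2;
     -3, 3, -1, -2;
     -2, 1, -1, -3;
     2, -1, -1, -3;
     -3, -3, 1, -2;
     3, 3, 1, -2;
     1, 2, 1, -3;
     -1, -2, 1, -3;
     0, 0, 0, 2]

/-- The right-hand side of the Klee–Walkup polytope realization `Q̃₄`. -/
def bQ : Fin 9 → ℝ := fun _ => -1

/-- The integer matrix underlying `AQ`. -/
def AZ : Matrix (Fin 9) (Fin 4) ℤ :=
  !![3, -3, -1, -2;
     -3, 3, -1, -2;
     -2, 1, -1, -3;
     2, -1, -1, -3;
     -3, -3, 1, -2;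
     3, 3, 1, -2;
     1, 2, 1, -3;
     -1, -2, 1, -3;
     0, 0, 0, 2]

/-- The value of the linear form with coefficients `AZ i` at `x`. -/
def rowEval (i : Fin 9) (x : Fin 4 → ℤ) : ℤ :=
  AZ i 0 * x 0 + AZ i 1 * x 1 + AZ i 2 * x 2 + AZ i 3 * x 3

/-- The minor of the rows `a, b, c` in columns `p, q, r`. -/
def det₃ (a b c : Fin 4 → ℤ) (p q r : Fin 4) : ℤ :=
  a p * (b q * c r - b r * c q) - a q * (b p * c r - b r * c p) + a r * (b p * c q - b q * c p)

/-- The generalized cross product of three rows of `AZ`. -/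
def cross (i j k : Fin 9) : Fin 4 → ℤ :=
  ![det₃ (AZ i) (AZ j) (AZ k) 1 2 3, -det₃ (AZ i) (AZ j) (AZ k) 0 2 3,
    det₃ (AZ i) (AZ j) (AZ k) 0 1 3, -det₃ (AZ i) (AZ j) (AZ k) 0 1 2]

/-- A point of `ℚ⁴` in homogeneous integer coordinates. -/
structure HomPoint where
  num : Fin 4 → ℤ
  den : ℤ

namespace HomPoint

/-- The real point with homogeneous coordinates `p`. -/
def toReal (p : HomPoint) : Fin 4 → ℝ := fun m => p.num m / p.den

/-- `den` times the slack of the `i`-th inequality at `p`. -/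
def slack (p : HomPoint) (i : Fin 9) : ℤ := rowEval i p.num + p.den

def Feasible (p : HomPoint) : Prop := ∀ i, 0 ≤ p.den * p.slack i

instance (p : HomPoint) : Decidable p.Feasible := inferInstanceAs (Decidable (∀ _, _))

/-- The `i`-th coordinate of `AQ (q - p)`, up to the factor `p.den * q.den`. -/
def slackDiff (p q : HomPoint) (i : Fin 9) : ℤ := q.slack i * p.den - p.slack i * q.den

/-- A symmetry of order four of `Q̃₄`. -/
def rot (p : HomPoint) : HomPoint := ⟨![-p.num 1, p.num 0, -p.num 2, p.num 3], p.den⟩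

/-- The orbit of `p` under the cyclic group generated by `rot`. -/
def orbit (p : HomPoint) : List HomPoint := [p, p.rot, p.rot.rot, p.rot.rot.rot]

end HomPoint

/-- The vector `e` of row values vanishes on three independent rows of `AZ`. -/
def HasCircuitZeros (e : Fin 9 → ℤ) : Prop :=
  ∃ i, e i = 0 ∧ ∃ j, i < j ∧ e j = 0 ∧ ∃ k, j < k ∧ e k = 0 ∧ cross i j k ≠ 0

instance (e : Fin 9 → ℤ) : Decidable (HasCircuitZeros e) := inferInstanceAs (Decidable (∃ _, _))

/-- A criterion for the segment from `p` to `q` to be a maximal circuit step. -/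
def MaximalStep (p q : HomPoint) : Prop :=
  (∃ r, q.slack r = 0 ∧ p.slackDiff q r < 0) ∧ HasCircuitZeros (p.slackDiff q)

instance (p q : HomPoint) : Decidable (MaximalStep p q) := inferInstanceAs (Decidable (_ ∧ _))

/-- The vertices of `Q̃₄`. -/
def vertices : List HomPoint :=
  [⟨![0, 0, -1, 0], 1⟩, ⟨![0, 0, 1, 0], 1⟩, ⟨![0, 0, 0, 1], 3⟩] ++
  [(⟨![-8, -7, 21, -6], 12⟩ : HomPoint), ⟨![-20, 19, -57, -15], 30⟩, ⟨![-1, -1, 4, -1], 2⟩,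
    ⟨![-2, 1, -3, 3], 12⟩, ⟨![-3, 1, -3, 5], 19⟩, ⟨![-4, 2, -5, 8], 29⟩].flatMap HomPoint.orbit

/-- Further points through which shortest circuit walks are routed. -/
def wayPoints : List HomPoint :=
  [(⟨![-4, 1, -3, 0], 12⟩ : HomPoint), ⟨![-1, 0, 0, 0], 3⟩, ⟨![-10, -10, 49, -10], 29⟩,
    ⟨![-13, 1, -8, 25], 94⟩].flatMap HomPoint.orbit

/-- The determinant of the rows `i, j, k, l` of `AZ`. -/
def det₄ (i j k l : Fin 9) : ℤ := rowEval i (cross j k l)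

/-- The Cramer rule numerators for the point where the constraints `i, j, k, l` are tight. -/
def cramerNum (i j k l : Fin 9) : Fin 4 → ℤ := fun m =>
  cross i k l m + cross i j k m - cross j k l m - cross i j l m

/-- The point where the line through `p` in direction `n` meets the `r`-th hyperplane. -/
def hit (p : HomPoint) (n : Fin 4 → ℤ) (r : Fin 9) : HomPoint :=
  ⟨fun m => p.num m * rowEval r n - p.slack r * n m, p.den * rowEval r n⟩

lemma AQ_apply (i : Fin 9) (m : Fin 4) : AQ i m = AZ i m := by
  fin_cases i <;> fin_cases m <;> simp [AQ, AZ]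

lemma AQ_mulVec (x : Fin 4 → ℝ) (i : Fin 9) :
    AQ.mulVec x i = AZ i 0 * x 0 + AZ i 1 * x 1 + AZ i 2 * x 2 + AZ i 3 * x 3 := by
  simp [mulVec, dotProduct, Fin.sum_univ_four, AQ_apply]

lemma AQ_mulVec_intCast (x : Fin 4 → ℤ) (i : Fin 9) :
    AQ.mulVec (fun m => (x m : ℝ)) i = rowEval i x := by
  simp [AQ_mulVec, rowEval]

/-- Cofactor expansion along an arbitrary real first row. -/
lemma det_eq_sum_mul_cross (x : Fin 4 → ℝ) (i j k : Fin 9) :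
    det (of ![x, AQ i, AQ j, AQ k]) = ∑ m, x m * (cross i j k m : ℝ) := by
  simp [det_succ_row_zero, Fin.sum_univ_succ, AQ_apply, cross, det₃, Fin.succAbove]
  ring

lemma det_rows (i j k l : Fin 9) : det (of ![AQ i, AQ j, AQ k, AQ l]) = det₄ i j k l := by
  simp [det_eq_sum_mul_cross, det₄, rowEval, Fin.sum_univ_four, AQ_apply]

lemma AQ_mulVec_toReal {p : HomPoint} (hp : p.den ≠ 0) (i : Fin 9) :
    AQ.mulVec p.toReal i = p.slack i / p.den - 1 := by
  have : (p.den : ℝ) ≠ 0 := mod_cast hp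
  simp only [AQ_mulVec, HomPoint.toReal, HomPoint.slack, rowEval]
  field_simp
  push_cast
  ring

lemma toReal_mem_polySet {p : HomPoint} (hp : p.den ≠ 0) :
    p.toReal ∈ polySet AQ bQ ↔ p.Feasible := by
  refine forall_congr' fun i => ?_
  have h0 : (p.den : ℝ) ≠ 0 := mod_cast hp
  have h1 : (p.slack i : ℝ) / p.den = (p.den * p.slack i : ℤ) / (p.den : ℝ) ^ 2 := by
    push_cast; field_simp
  have h2 : (0 : ℝ) < (p.den : ℝ) ^ 2 := by positivity
  rw [AQ_mulVec_toReal hp, h1, bQ, ← sub_nonneg, sub_neg_eq_add, sub_add_cancel,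
    le_div_iff₀ h2, zero_mul, Int.cast_nonneg_iff]

lemma AQ_mulVec_sub_toReal {p q : HomPoint} (hp : p.den ≠ 0) (hq : q.den ≠ 0) (i : Fin 9) :
    AQ.mulVec (q.toReal - p.toReal) i = p.slackDiff q i / (p.den * q.den) := by
  have : (p.den : ℝ) ≠ 0 := mod_cast hp
  have : (q.den : ℝ) ≠ 0 := mod_cast hq
  rw [mulVec_sub, Pi.sub_apply, AQ_mulVec_toReal hp, AQ_mulVec_toReal hq, HomPoint.slackDiff]
  field_simp
  push_cast
  ring

/-- A matrix of rank `r` has `r` linearly independent rows, listed in increasing order. -/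
lemma exists_strictMono_linearIndependent_rows {ι : Type*} [Fintype ι] [LinearOrder ι] {n r : ℕ}
    (M : Matrix ι (Fin n) ℝ) (h : Module.finrank ℝ (LinearMap.ker M.mulVecLin) + r = n) :
    ∃ f : Fin r → ι, StrictMono f ∧ LinearIndependent ℝ (fun i => M (f i)) := by
  have hr : Module.finrank ℝ (Submodule.span ℝ (Set.range M)) = r := by
    have h1 := M.rank_eq_finrank_span_row
    have h2 := LinearMap.finrank_range_add_finrank_ker M.mulVecLin
    rw [Module.finrank_fin_fun] at h2
    change M.rank + _ = _ at h2
    change M.rank = Module.finrank ℝ (Submodule.span ℝ (Set.range M)) at h1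
    omega
  subst hr
  obtain ⟨g, hg, -, hli⟩ := Submodule.exists_fun_fin_finrank_span_eq ℝ (Set.range M)
  choose f hf using hg
  obtain rfl : g = fun i => M (f i) := funext fun i => (hf i).symm
  have hinj : Function.Injective f := fun i j hij => hli.injective (by simp [hij])
  exact ⟨f ∘ Tuple.sort f,
    (Tuple.monotone_sort f).strictMono_of_injective (hinj.comp (Tuple.sort f).injective),
    hli.comp _ (Tuple.sort f).injective⟩

/-- Two vectors killed by three independent rows are parallel. -/
lemma eq_smul_of_cross_ne_zero {i j k : Fin 9} (h : cross i j k ≠ 0) {x : Fin 4 → ℝ}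
    (hi : AQ.mulVec x i = 0) (hj : AQ.mulVec x j = 0) (hk : AQ.mulVec x k = 0) :
    ∃ t : ℝ, x = t • fun m => (cross i j k m : ℝ) := by
  set n : Fin 4 → ℝ := fun m => (cross i j k m : ℝ) with hn
  have hrow (l : Fin 9) : AQ l ⬝ᵥ n = rowEval l (cross i j k) := AQ_mulVec_intCast _ _
  have hn0 : n ⬝ᵥ n ≠ 0 := by
    rw [Ne, dotProduct_self_eq_zero]
    contrapose! h
    exact funext fun m => Int.cast_eq_zero.mp (congrFun h m)
  have hdet : det (of ![n, AQ i, AQ j, AQ k]) ≠ 0 := by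
    rw [det_eq_sum_mul_cross]; exact hn0
  refine ⟨n ⬝ᵥ x / n ⬝ᵥ n, sub_eq_zero.mp (eq_zero_of_mulVec_eq_zero hdet ?_)⟩
  have hi' : AQ i ⬝ᵥ n = 0 := by
    rw [hrow]; norm_cast; simp [rowEval, cross, det₃]; ring
  have hj' : AQ j ⬝ᵥ n = 0 := by
    rw [hrow]; norm_cast; simp [rowEval, cross, det₃]; ring
  have hk' : AQ k ⬝ᵥ n = 0 := by
    rw [hrow]; norm_cast; simp [rowEval, cross, det₃]; ring
  have hi : AQ i ⬝ᵥ x = 0 := hi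
  have hj : AQ j ⬝ᵥ x = 0 := hj
  have hk : AQ k ⬝ᵥ x = 0 := hk
  ext l
  fin_cases l <;>
    simp [mulVec, dotProduct_sub, dotProduct_smul, hi, hj, hk, hi', hj', hk',
      div_mul_cancel₀ _ hn0]

lemma AQ_eq_zero_of_mulVec {x : Fin 4 → ℝ} (h : AQ.mulVec x = 0) : x = 0 := by
  have h' := fun i => congrFun h i
  simp [AQ_mulVec, AZ, Fin.forall_fin_succ] at h'
  ext m
  fin_cases m <;> simp <;> linarith

/-- Circuits are the nonzero vectors killed by three independent rows. -/
lemma isCircuit_iff {g : Fin 4 → ℝ} :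
    IsCircuit AQ g ↔ g ≠ 0 ∧ ∃ i j k, i < j ∧ j < k ∧ cross i j k ≠ 0 ∧
      AQ.mulVec g i = 0 ∧ AQ.mulVec g j = 0 ∧ AQ.mulVec g k = 0 := by
  constructor
  · rintro ⟨hg, hmin⟩
    refine ⟨hg, ?_⟩
    let M : Matrix {i // AQ.mulVec g i = 0} (Fin 4) ℝ := fun i => AQ i
    have hgM : g ∈ LinearMap.ker M.mulVecLin := by
      ext i; exact i.2
    have hker : Module.finrank ℝ (LinearMap.ker M.mulVecLin) = 1 := by
      refine finrank_eq_one ⟨g, hgM⟩ (by simpa using hg) ?_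
      rintro ⟨w, hw⟩
      obtain ⟨l, hl⟩ : ∃ l, AQ.mulVec g l ≠ 0 := by
        by_contra! h
        exact hg (AQ_eq_zero_of_mulVec (funext h))
      refine ⟨AQ.mulVec w l / AQ.mulVec g l, Subtype.ext ?_⟩
      by_contra hne
      set c := AQ.mulVec w l / AQ.mulVec g l with hc
      have hval (i) : AQ.mulVec (w - c • g) i = AQ.mulVec w i - c * AQ.mulVec g i := by
        simp [mulVec_sub, mulVec_smul]
      have hsub := hmin (w - c • g) (fun h => hne (sub_eq_zero.mp h).symm) ?_
      · have : l ∈ {i | AQ.mulVec (w - c • g) i ≠ 0} := hsub ▸ hl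
        apply this
        rw [hval, hc, div_mul_cancel₀ _ hl, sub_self]
      · intro i hi hgi
        apply hi
        have : AQ.mulVec w i = 0 := congrFun (show M.mulVec w = 0 from hw) ⟨i, hgi⟩
        rw [hval, this, hgi, mul_zero, sub_zero]
    obtain ⟨f, hf, hli⟩ := exists_strictMono_linearIndependent_rows M (r := 3) (by rw [hker])
    refine ⟨f 0, f 1, f 2, hf (by decide), hf (by decide), ?_, (f 0).2, (f 1).2, (f 2).2⟩
    intro h0
    have hperp : g ∉ Submodule.span ℝ (Set.range fun i => M (f i)) := by
      intro hmem
      have : ∀ x ∈ Submodule.span ℝ (Set.range fun i => M (f i)), x ⬝ᵥ g = 0 := by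
        intro x hx
        induction hx using Submodule.span_induction with
        | mem x hx => obtain ⟨i, rfl⟩ := hx; exact (f i).2
        | zero => simp
        | add x y _ _ hx hy => rw [add_dotProduct, hx, hy, add_zero]
        | smul a x _ hx => rw [smul_dotProduct, hx, smul_zero]
      exact hg (dotProduct_self_eq_zero.mp (this g hmem))
    have hli' : LinearIndependent ℝ (of ![g, AQ (f 0), AQ (f 1), AQ (f 2)]).row := by
      have hrows : (of ![g, AQ (f 0), AQ (f 1), AQ (f 2)]).row =
          (Fin.cons g fun i => M (f i) : Fin 4 → Fin 4 → ℝ) := by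
        ext i m
        fin_cases i <;> rfl
      rw [hrows]
      exact linearIndependent_finCons.mpr ⟨hli, hperp⟩
    rw [linearIndependent_rows_iff_isUnit, isUnit_iff_isUnit_det, isUnit_iff_ne_zero,
      det_eq_sum_mul_cross, h0] at hli'
    simp at hli'
  · rintro ⟨hg, i, j, k, -, -, hc, hi, hj, hk⟩
    refine ⟨hg, fun v hv hsub => ?_⟩
    have hz {l} (hl : AQ.mulVec g l = 0) : AQ.mulVec v l = 0 := by
      by_contra h
      exact hsub h hl
    obtain ⟨s, hs⟩ := eq_smul_of_cross_ne_zero hc hi hj hk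
    obtain ⟨t, ht⟩ := eq_smul_of_cross_ne_zero hc (hz hi) (hz hj) (hz hk)
    have hs0 : s ≠ 0 := by rintro rfl; simp [hs] at hg
    have ht0 : t ≠ 0 := by rintro rfl; simp [ht] at hv
    ext l
    simp [hs, ht, mulVec_smul, hs0, ht0]

/-- `y` is reached from `x` by one maximal step in a circuit direction. -/
def IsCircuitStep (x y : Fin 4 → ℝ) : Prop :=
  ∃ g : Fin 4 → ℝ, ∃ α : ℝ, IsCircuit AQ g ∧ 0 < α ∧ y = x + α • g ∧
    ∀ β : ℝ, α < β → x + β • g ∉ polySet AQ bQ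

lemma isCircuitWalk_zero {u v : Fin 4 → ℝ} :
    IsCircuitWalk AQ bQ 0 u v ↔ u = v ∧ u ∈ polySet AQ bQ := by
  constructor
  · rintro ⟨y, rfl, rfl, hy, -⟩
    exact ⟨rfl, hy 0⟩
  · rintro ⟨rfl, hu⟩
    exact ⟨fun _ => u, rfl, rfl, fun _ => hu, fun i => i.elim0⟩

lemma isCircuitWalk_succ {k : ℕ} {u v : Fin 4 → ℝ} :
    IsCircuitWalk AQ bQ (k + 1) u v ↔
      u ∈ polySet AQ bQ ∧ ∃ y, IsCircuitStep u y ∧ IsCircuitWalk AQ bQ k y v := by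
  constructor
  · rintro ⟨y, rfl, rfl, hy, hs⟩
    exact ⟨hy 0, y 1, hs 0, fun i => y i.succ, rfl, rfl, fun i => hy i.succ, fun i => hs i.succ⟩
  · rintro ⟨hu, _, h, y, rfl, rfl, hy, hs⟩
    refine ⟨Fin.cons u y, rfl, rfl, Fin.cases hu hy, Fin.cases h hs⟩

lemma isCircuitStep_of_maximalStep {p q : HomPoint} (hp : 0 < p.den) (hq : 0 < q.den)
    (h : MaximalStep p q) : IsCircuitStep p.toReal q.toReal := by
  obtain ⟨⟨r, hr, hneg⟩, i, hi, j, hij, hj, k, hjk, hk, hc⟩ := h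
  have hval := AQ_mulVec_sub_toReal hp.ne' hq.ne'
  have hrow : AQ.mulVec (q.toReal - p.toReal) r < 0 := by
    rw [hval]
    exact div_neg_of_neg_of_pos (mod_cast hneg) (mul_pos (mod_cast hp) (mod_cast hq))
  refine ⟨q.toReal - p.toReal, 1, isCircuit_iff.mpr ⟨?_, i, j, k, hij, hjk, hc, ?_, ?_, ?_⟩,
    one_pos, by simp, fun β hβ hmem => ?_⟩
  · intro h0
    simp [h0] at hrow
  · simp [hval, hi]
  · simp [hval, hj]
  · simp [hval, hk]
  · have h1 := hmem r
    have h2 : p.toReal + β • (q.toReal - p.toReal) =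
        q.toReal + (β - 1) • (q.toReal - p.toReal) := by
      ext m; simp; ring
    rw [h2, mulVec_add, mulVec_smul, Pi.add_apply, AQ_mulVec_toReal hq.ne', hr, bQ] at h1
    simp only [Pi.smul_apply, smul_eq_mul, Int.cast_zero, zero_div] at h1
    nlinarith [mul_neg_of_pos_of_neg (sub_pos.mpr hβ) hrow]

/-- If `g` is orthogonal to the constraints tight at `y`, short steps from `y` along `±g` stay in
the polyhedron. -/
lemma exists_pos_forall_add_smul_mem {y g : Fin 4 → ℝ} (hy : y ∈ polySet AQ bQ)
    (h : ∀ r, AQ.mulVec y r = -1 → AQ.mulVec g r = 0) :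
    ∃ δ > 0, ∀ ε : ℝ, |ε| < δ → y + ε • g ∈ polySet AQ bQ := by
  have hloc : ∀ r, ∃ δ > 0, ∀ ε : ℝ, |ε| < δ → -1 ≤ AQ.mulVec (y + ε • g) r := by
    intro r
    have hr : -1 ≤ AQ.mulVec y r := hy r
    simp only [mulVec_add, mulVec_smul, Pi.add_apply, Pi.smul_apply, smul_eq_mul]
    rcases hr.eq_or_lt with heq | hlt
    · exact ⟨1, one_pos, fun ε _ => by rw [h r heq.symm, mul_zero, add_zero]; exact hr⟩
    · refine ⟨(AQ.mulVec y r + 1) / (|AQ.mulVec g r| + 1),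
        div_pos (by linarith) (by positivity), fun ε hε => ?_⟩
      rw [lt_div_iff₀ (by positivity)] at hε
      have h1 := neg_abs_le (ε * AQ.mulVec g r)
      rw [abs_mul] at h1
      nlinarith [abs_nonneg ε]
  choose δ hδ hδ' using hloc
  obtain ⟨r₀, -, hr₀⟩ := Finset.exists_min_image Finset.univ δ ⟨0, Finset.mem_univ _⟩
  exact ⟨δ r₀, hδ r₀, fun ε hε r => hδ' r ε (hε.trans_le (hr₀ r (Finset.mem_univ r)))⟩

lemma IsCircuitStep.exists_blocking_row {x y : Fin 4 → ℝ} (h : IsCircuitStep x y)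
    (hy : y ∈ polySet AQ bQ) : ∃ r, AQ.mulVec y r = -1 ∧ AQ.mulVec (y - x) r ≠ 0 := by
  obtain ⟨g, α, -, hα, rfl, hmax⟩ := h
  by_contra! hr
  obtain ⟨δ, hδ, hmem⟩ := exists_pos_forall_add_smul_mem (g := g) hy fun r hr' => by
    simpa [mulVec_smul, hα.ne'] using hr r hr'
  refine hmax (α + δ / 2) (by linarith) ?_
  rw [add_smul, ← add_assoc]
  exact hmem _ (by rw [abs_of_pos] <;> linarith)

lemma IsCircuitStep.exists_cross_ne_zero {x y : Fin 4 → ℝ} (h : IsCircuitStep x y) :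
    ∃ i j k, i < j ∧ j < k ∧ cross i j k ≠ 0 ∧ AQ.mulVec (y - x) i = 0 ∧
      AQ.mulVec (y - x) j = 0 ∧ AQ.mulVec (y - x) k = 0 := by
  obtain ⟨g, α, hg, -, rfl, -⟩ := h
  obtain ⟨-, i, j, k, hij, hjk, hc, hi, hj, hk⟩ := isCircuit_iff.mp hg
  exact ⟨i, j, k, hij, hjk, hc, by simp [mulVec_smul, hi, hj, hk]⟩

lemma hasCircuitZeros_of_isCircuitStep {p q : HomPoint} (hp : p.den ≠ 0) (hq : q.den ≠ 0)
    (h : IsCircuitStep p.toReal q.toReal) : HasCircuitZeros (p.slackDiff q) := by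
  obtain ⟨i, j, k, hij, hjk, hc, hi, hj, hk⟩ := h.exists_cross_ne_zero
  have hz {l} (hl : AQ.mulVec (q.toReal - p.toReal) l = 0) : p.slackDiff q l = 0 := by
    simpa [AQ_mulVec_sub_toReal hp hq, hp, hq] using hl
  exact ⟨i, hz hi, j, hij, hz hj, k, hjk, hz hk, hc⟩

/-- Every circuit step from `p` ends where a line in a cross product direction meets a facet
hyperplane. -/
lemma exists_eq_toReal_hit {p : HomPoint} (hp : p.den ≠ 0) {y : Fin 4 → ℝ}
    (h : IsCircuitStep p.toReal y) (hy : y ∈ polySet AQ bQ) :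
    ∃ i j k r, i < j ∧ j < k ∧ cross i j k ≠ 0 ∧ rowEval r (cross i j k) ≠ 0 ∧
      y = (hit p (cross i j k) r).toReal := by
  obtain ⟨i, j, k, hij, hjk, hc, hi, hj, hk⟩ := h.exists_cross_ne_zero
  obtain ⟨r, hr, hr'⟩ := h.exists_blocking_row hy
  obtain ⟨t, ht⟩ := eq_smul_of_cross_ne_zero hc hi hj hk
  have hsub : AQ.mulVec (y - p.toReal) r = t * rowEval r (cross i j k) := by
    rw [ht, mulVec_smul, Pi.smul_apply, AQ_mulVec_intCast, smul_eq_mul]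
  have hn : rowEval r (cross i j k) ≠ 0 := by
    rintro h0
    exact hr' (by rw [hsub, h0, Int.cast_zero, mul_zero])
  refine ⟨i, j, k, r, hij, hjk, hc, hn, ?_⟩
  have hn' : (rowEval r (cross i j k) : ℝ) ≠ 0 := mod_cast hn
  have hp' : (p.den : ℝ) ≠ 0 := mod_cast hp
  rw [mulVec_sub, Pi.sub_apply, hr, AQ_mulVec_toReal hp] at hsub
  have ht' : t = -(p.slack r) / (p.den * rowEval r (cross i j k)) := by
    rw [eq_div_iff (mul_ne_zero hp' hn')]
    field_simp at hsub
    linear_combination -hsub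
  rw [sub_eq_iff_eq_add.mp ht, ht']
  ext m
  simp only [HomPoint.toReal, hit, Pi.add_apply, Pi.smul_apply, smul_eq_mul]
  push_cast
  field_simp
  ring

/-- The Cramer rule for the point where four constraints are tight. -/
lemma det₄_mul_eq_cramerNum {x : Fin 4 → ℝ} {i j k l : Fin 9} (hi : AQ.mulVec x i = -1)
    (hj : AQ.mulVec x j = -1) (hk : AQ.mulVec x k = -1) (hl : AQ.mulVec x l = -1) (m : Fin 4) :
    (det₄ i j k l : ℝ) * x m = cramerNum i j k l m := by
  rw [AQ_mulVec] at hi hj hk hl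
  have key : (det₄ i j k l : ℝ) * x m - cramerNum i j k l m =
      (AZ i 0 * x 0 + AZ i 1 * x 1 + AZ i 2 * x 2 + AZ i 3 * x 3 + 1) * cross j k l m -
      (AZ j 0 * x 0 + AZ j 1 * x 1 + AZ j 2 * x 2 + AZ j 3 * x 3 + 1) * cross i k l m +
      (AZ k 0 * x 0 + AZ k 1 * x 1 + AZ k 2 * x 2 + AZ k 3 * x 3 + 1) * cross i j l m -
      (AZ l 0 * x 0 + AZ l 1 * x 1 + AZ l 2 * x 2 + AZ l 3 * x 3 + 1) * cross i j k m := by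
    fin_cases m <;> simp [det₄, rowEval, cramerNum, cross, det₃] <;> ring
  rw [hi, hj, hk, hl] at key
  linear_combination key

lemma toReal_mem_extremePoints {p : HomPoint} (hp : p.den ≠ 0) (hfeas : p.Feasible)
    {i j k l : Fin 9} (hdet : det₄ i j k l ≠ 0) (hi : p.slack i = 0) (hj : p.slack j = 0)
    (hk : p.slack k = 0) (hl : p.slack l = 0) :
    p.toReal ∈ Set.extremePoints ℝ (polySet AQ bQ) := by
  refine ⟨(toReal_mem_polySet hp).mpr hfeas, fun x hx y hy ⟨a, b, ha, hb, hab, hxy⟩ => ?_⟩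
  have hp_tight {r} (hr : p.slack r = 0) : AQ.mulVec p.toReal r = -1 := by
    simp [AQ_mulVec_toReal hp, hr]
  have hx_tight {r} (hr : p.slack r = 0) : AQ.mulVec x r = -1 := by
    have h1 := hp_tight hr
    rw [← hxy, mulVec_add, mulVec_smul, mulVec_smul] at h1
    simp only [Pi.add_apply, Pi.smul_apply, smul_eq_mul] at h1
    have h2 : -1 ≤ AQ.mulVec x r := hx r
    have h3 : -1 ≤ AQ.mulVec y r := hy r
    nlinarith
  ext m
  have hdet' : (det₄ i j k l : ℝ) ≠ 0 := mod_cast hdet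
  apply mul_left_cancel₀ hdet'
  rw [det₄_mul_eq_cramerNum (hx_tight hi) (hx_tight hj) (hx_tight hk) (hx_tight hl),
    det₄_mul_eq_cramerNum (hp_tight hi) (hp_tight hj) (hp_tight hk) (hp_tight hl)]

/-- Four independent constraints are tight at an extreme point. -/
lemma exists_tight_of_mem_extremePoints {u : Fin 4 → ℝ}
    (hu : u ∈ Set.extremePoints ℝ (polySet AQ bQ)) :
    ∃ i j k l, i < j ∧ j < k ∧ k < l ∧ det₄ i j k l ≠ 0 ∧ AQ.mulVec u i = -1 ∧
      AQ.mulVec u j = -1 ∧ AQ.mulVec u k = -1 ∧ AQ.mulVec u l = -1 := by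
  let M : Matrix {i // AQ.mulVec u i = -1} (Fin 4) ℝ := fun i => AQ i
  have hker : LinearMap.ker M.mulVecLin = ⊥ := by
    refine (Submodule.eq_bot_iff _).mpr fun w hw => ?_
    obtain ⟨δ, hδ, hmem⟩ := exists_pos_forall_add_smul_mem hu.1 (g := w) fun r hr =>
      congrFun (show M.mulVec w = 0 from hw) ⟨r, hr⟩
    have h1 := hmem (δ / 2) (by rw [abs_of_pos] <;> linarith)
    have h2 := hmem (-(δ / 2)) (by rw [abs_neg, abs_of_pos] <;> linarith)
    have h3 := hu.2 h1 h2 ⟨1 / 2, 1 / 2, by norm_num, by norm_num, by norm_num, by module⟩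
    simpa [hδ.ne'] using h3
  obtain ⟨f, hf, hli⟩ := exists_strictMono_linearIndependent_rows M (r := 4) (by simp [hker])
  refine ⟨f 0, f 1, f 2, f 3, hf (by decide), hf (by decide), hf (by decide), ?_,
    (f 0).2, (f 1).2, (f 2).2, (f 3).2⟩
  have hrows : (of ![AQ (f 0), AQ (f 1), AQ (f 2), AQ (f 3)]).row = fun i => M (f i) := by
    ext i m
    fin_cases i <;> rfl
  rw [← hrows, linearIndependent_rows_iff_isUnit, isUnit_iff_isUnit_det, isUnit_iff_ne_zero,
    det_rows] at hli
  exact_mod_cast hli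

lemma den_pos_of_mem : ∀ p ∈ vertices ++ wayPoints, 0 < p.den := by decide +kernel

lemma feasible_of_mem : ∀ p ∈ vertices ++ wayPoints, p.Feasible := by decide +kernel

lemma basic_infeasible_or_mem_vertices :
    ∀ i j, i < j → ∀ k, j < k → ∀ l, k < l → det₄ i j k l ≠ 0 →
      (∃ r, det₄ i j k l * (rowEval r (cramerNum i j k l) + det₄ i j k l) < 0) ∨
      ∃ p ∈ vertices, ∀ m, p.den * cramerNum i j k l m = det₄ i j k l * p.num m := by
  decide +kernel

lemma exists_mem_vertices_of_mem_extremePoints {u : Fin 4 → ℝ}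
    (hu : u ∈ Set.extremePoints ℝ (polySet AQ bQ)) : ∃ p ∈ vertices, u = p.toReal := by
  obtain ⟨i, j, k, l, hij, hjk, hkl, hdet, hi, hj, hk, hl⟩ := exists_tight_of_mem_extremePoints hu
  have hcramer := det₄_mul_eq_cramerNum hi hj hk hl
  rcases basic_infeasible_or_mem_vertices i j hij k hjk l hkl hdet with ⟨r, hr⟩ | ⟨p, hp, hpm⟩
  · have h1 : (rowEval r (cramerNum i j k l) : ℝ) = det₄ i j k l * AQ.mulVec u r := by
      rw [← AQ_mulVec_intCast, ← funext hcramer]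
      exact congrFun (mulVec_smul AQ (det₄ i j k l : ℝ) u) r
    have h2 : -1 ≤ AQ.mulVec u r := hu.1 r
    have h3 : (det₄ i j k l : ℝ) * (rowEval r (cramerNum i j k l) + det₄ i j k l) < 0 :=
      mod_cast hr
    rw [h1] at h3
    nlinarith [mul_nonneg (sq_nonneg (det₄ i j k l : ℝ)) (neg_le_iff_add_nonneg.mp h2)]
  · refine ⟨p, hp, funext fun m => ?_⟩
    have hden : (p.den : ℝ) ≠ 0 :=
      mod_cast (den_pos_of_mem p (List.mem_append_left _ hp)).ne'
    have hdet' : (det₄ i j k l : ℝ) ≠ 0 := mod_cast hdet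
    have h1 : (p.den : ℝ) * cramerNum i j k l m = det₄ i j k l * p.num m := mod_cast hpm m
    rw [HomPoint.toReal, eq_div_iff hden]
    apply mul_left_cancel₀ hdet'
    linear_combination h1 + (p.den : ℝ) * hcramer m

/-- The listed points reachable from `p` by one maximal circuit step. -/
def successors (p : HomPoint) : List HomPoint := (vertices ++ wayPoints).filter (MaximalStep p ·)

lemma exists_route : ∀ u ∈ vertices, ∀ v ∈ vertices,
    ∃ p ∈ successors u, ∃ q ∈ successors p, MaximalStep q v := by
  decide +kernel

lemma exists_isCircuitWalk_three {u v : HomPoint} (hu : u ∈ vertices) (hv : v ∈ vertices) :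
    IsCircuitWalk AQ bQ 3 u.toReal v.toReal := by
  obtain ⟨p, hp, q, hq, hqv⟩ := exists_route u hu v hv
  obtain ⟨hp, hup⟩ : p ∈ vertices ++ wayPoints ∧ MaximalStep u p := by
    simpa only [successors, List.mem_filter, decide_eq_true_eq] using hp
  obtain ⟨hq, hpq⟩ : q ∈ vertices ++ wayPoints ∧ MaximalStep p q := by
    simpa only [successors, List.mem_filter, decide_eq_true_eq] using hq
  replace hu := List.mem_append_left wayPoints hu
  replace hv := List.mem_append_left wayPoints hv
  have hmem {w} (hw : w ∈ vertices ++ wayPoints) : w.toReal ∈ polySet AQ bQ :=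
    (toReal_mem_polySet (den_pos_of_mem w hw).ne').mpr (feasible_of_mem w hw)
  have hstep {w w'} (hw : w ∈ vertices ++ wayPoints) (hw' : w' ∈ vertices ++ wayPoints)
      (h : MaximalStep w w') : IsCircuitStep w.toReal w'.toReal :=
    isCircuitStep_of_maximalStep (den_pos_of_mem w hw) (den_pos_of_mem w' hw') h
  exact isCircuitWalk_succ.mpr ⟨hmem hu, _, hstep hu hp hup,
    isCircuitWalk_succ.mpr ⟨hmem hp, _, hstep hp hq hpq,
      isCircuitWalk_succ.mpr ⟨hmem hq, _, hstep hq hv hqv,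
        isCircuitWalk_zero.mpr ⟨rfl, hmem hv⟩⟩⟩⟩

def topVertex : HomPoint := ⟨![0, 0, 1, 0], 1⟩

def apexVertex : HomPoint := ⟨![0, 0, 0, 1], 3⟩

lemma not_hasCircuitZeros_hit : ∀ i j, i < j → ∀ k, j < k → cross i j k ≠ 0 →
    ∀ r, rowEval r (cross i j k) ≠ 0 → (hit topVertex (cross i j k) r).Feasible →
      ¬ HasCircuitZeros ((hit topVertex (cross i j k) r).slackDiff apexVertex) := by
  decide +kernel

lemma topVertex_ne_apexVertex : topVertex.toReal ≠ apexVertex.toReal := fun h => by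
  simpa [HomPoint.toReal, topVertex, apexVertex] using congrFun h 2

lemma not_isCircuitWalk_topVertex_apexVertex {k : ℕ} (hk : k ≤ 2) :
    ¬ IsCircuitWalk AQ bQ k topVertex.toReal apexVertex.toReal := by
  intro h
  have hapex : apexVertex.den ≠ 0 := by decide
  have htop : topVertex.den ≠ 0 := by decide
  interval_cases k
  · exact topVertex_ne_apexVertex (isCircuitWalk_zero.mp h).1
  · obtain ⟨-, _, hstep, hwalk⟩ := isCircuitWalk_succ.mp h
    obtain ⟨rfl, -⟩ := isCircuitWalk_zero.mp hwalk
    exact absurd (hasCircuitZeros_of_isCircuitStep htop hapex hstep) (by decide +kernel)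
  · obtain ⟨-, y, hstep, hwalk⟩ := isCircuitWalk_succ.mp h
    obtain ⟨hy, _, hstep', hwalk'⟩ := isCircuitWalk_succ.mp hwalk
    obtain ⟨rfl, -⟩ := isCircuitWalk_zero.mp hwalk'
    obtain ⟨i, j, k, r, hij, hjk, hc, hr, rfl⟩ := exists_eq_toReal_hit htop hstep hy
    have hden : (hit topVertex (cross i j k) r).den ≠ 0 := mul_ne_zero htop hr
    exact not_hasCircuitZeros_hit i j hij k hjk hc r hr ((toReal_mem_polySet hden).mp hy)
      (hasCircuitZeros_of_isCircuitStep hden hapex hstep')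

/-- The circuit diameter of the realization `Q̃₄ = {x ∈ ℝ⁴ : A_Q x ≥ b_Q}` of the Klee–Walkup
polytope equals 3: every ordered pair of vertices is joined by a circuit walk of length at
most 3, and some ordered pair of vertices admits no circuit walk of length at most 2. -/
theorem Q4_circuit_diameter_eq_three :
    (∀ u v : Fin 4 → ℝ, u ∈ Set.extremePoints ℝ (polySet AQ bQ) →
      v ∈ Set.extremePoints ℝ (polySet AQ bQ) →
      ∃ k ≤ 3, IsCircuitWalk AQ bQ k u v) ∧
    (∃ u v : Fin 4 → ℝ, u ∈ Set.extremePoints ℝ (polySet AQ bQ) ∧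
      v ∈ Set.extremePoints ℝ (polySet AQ bQ) ∧
      ∀ k ≤ 2, ¬ IsCircuitWalk AQ bQ k u v) := by
  refine ⟨fun u v hu hv => ?_, topVertex.toReal, apexVertex.toReal, ?_, ?_, fun k hk =>
    not_isCircuitWalk_topVertex_apexVertex hk⟩
  · obtain ⟨p, hp, rfl⟩ := exists_mem_vertices_of_mem_extremePoints hu
    obtain ⟨q, hq, rfl⟩ := exists_mem_vertices_of_mem_extremePoints hv
    exact ⟨3, le_rfl, exists_isCircuitWalk_three hp hq⟩
  · exact toReal_mem_extremePoints (i := 0) (j := 1) (k := 2) (l := 3)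
      (by decide) (by decide +kernel) (by decide +kernel) (by decide +kernel) (by decide +kernel)
      (by decide +kernel) (by decide +kernel)
  · exact toReal_mem_extremePoints (i := 2) (j := 3) (k := 6) (l := 7)
      (by decide) (by decide +kernel) (by decide +kernel) (by decide +kernel) (by decide +kernel)
      (by decide +kernel) (by decide +kernel)
end
end

section
/- The matrix A_Q defining the Klee-Walkup polytope realization Q̃₄ has exactly 84 circuits up to sign; equivalently, the set of circuits of A_Q normalized to coprime integer components has exactly 168 elements. -/
open Matrix

noncomputable section

/-- The set of rows of `A` that vanish at `v`. -/
def zeroRows {m n : ℕ} {R : Type*} [CommRing R] [DecidableEq R] (A : Matrix (Fin m) (Fin n) R)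
    (v : Fin n → R) : Finset (Fin m) :=
  Finset.univ.filter fun i => A.mulVec v i = 0

theorem mem_zeroRows {m n : ℕ} {R : Type*} [CommRing R] [DecidableEq R]
    {A : Matrix (Fin m) (Fin n) R} {v : Fin n → R} {i : Fin m} :
    i ∈ zeroRows A v ↔ A.mulVec v i = 0 := by
  simp [zeroRows]

/-- A matrix all of whose maximal minors (on increasing sequences of rows) are nonzero. -/
def HasNonzeroMinors {m n : ℕ} {R : Type*} [CommRing R] (A : Matrix (Fin m) (Fin n) R) : Prop :=
  ∀ f : Fin n → Fin m, StrictMono f → (A.submatrix f id).det ≠ 0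

/-- If the maximal minors are nonzero, a vector at which `n` rows vanish is zero. -/
theorem HasNonzeroMinors.eq_zero {m n : ℕ} {R : Type*} [CommRing R] [IsDomain R] [DecidableEq R]
    {A : Matrix (Fin m) (Fin n) R} (hA : HasNonzeroMinors A) {v : Fin n → R}
    {t : Finset (Fin m)} (ht : t ⊆ zeroRows A v) (hn : n ≤ t.card) : v = 0 := by
  obtain ⟨u, hut, hu⟩ := Finset.exists_subset_card_eq hn
  refine Matrix.eq_zero_of_mulVec_eq_zero (hA (u.orderEmbOfFin hu) (OrderEmbedding.strictMono _)) ?_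
  funext k
  exact (mem_zeroRows (A := A)).1 (ht (hut (u.orderEmbOfFin_mem hu k)))

theorem HasNonzeroMinors.card_zeroRows_le {m n : ℕ} {R : Type*} [CommRing R] [IsDomain R]
    [DecidableEq R] {A : Matrix (Fin m) (Fin (n + 1)) R} (hA : HasNonzeroMinors A)
    {v : Fin (n + 1) → R} (hv : v ≠ 0) : (zeroRows A v).card ≤ n := by
  by_contra! h
  exact hv (hA.eq_zero (subset_refl _) h)

theorem HasNonzeroMinors.map_intCast {m n : ℕ} {A : Matrix (Fin m) (Fin n) ℤ}
    (hA : HasNonzeroMinors A) : HasNonzeroMinors (A.map ((↑) : ℤ → ℝ)) := by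
  intro f hf h
  have h' : (((A.submatrix f id).det : ℤ) : ℝ) = 0 := by
    rw [← h, Int.cast_det]
    rfl
  exact hA f hf (by exact_mod_cast h')

theorem mulVec_map_intCast {m n : ℕ} (A : Matrix (Fin m) (Fin n) ℤ) (z : Fin n → ℤ) (i : Fin m) :
    (A.map ((↑) : ℤ → ℝ)).mulVec (fun j => (z j : ℝ)) i = (A.mulVec z i : ℤ) := by
  simp [Matrix.mulVec, dotProduct]

theorem ne_zero_of_gcd_eq_one {n : ℕ} {z : Fin n → ℤ} (hz : Finset.univ.gcd z = 1) : z ≠ 0 := by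
  rintro rfl
  exact zero_ne_one ((Finset.gcd_eq_zero_iff.2 fun _ _ => rfl).symm.trans hz)

/-- Any `n` rows of an integer matrix with `n + 1` columns vanish at a common primitive vector. -/
theorem exists_primitive_subset_zeroRows {m n : ℕ} (A : Matrix (Fin m) (Fin (n + 1)) ℤ)
    {s : Finset (Fin m)} (hs : s.card = n) :
    ∃ z : Fin (n + 1) → ℤ, Finset.univ.gcd z = 1 ∧ s ⊆ zeroRows A z := by
  let M : Matrix (Fin (n + 1)) (Fin (n + 1)) ℤ :=
    Matrix.of (Fin.cons 0 fun k => A (s.orderEmbOfFin hs k))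
  have hM : M.det = 0 := Matrix.det_eq_zero_of_row_eq_zero 0 fun _ => rfl
  obtain ⟨v, hv, hMv⟩ := Matrix.exists_mulVec_eq_zero_iff.2 hM
  obtain ⟨z, hz, hz1⟩ := Finset.extract_gcd v Finset.univ_nonempty
  have hvz : v = Finset.univ.gcd v • z := funext fun i => hz i (Finset.mem_univ i)
  have hg : Finset.univ.gcd v ≠ 0 := fun h => hv (by rw [hvz, h, zero_smul])
  refine ⟨z, hz1, fun i hi => mem_zeroRows.2 ?_⟩
  have hi' : i ∈ Set.range (s.orderEmbOfFin hs) := by simpa using hi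
  obtain ⟨k, rfl⟩ := hi'
  have hk : A.mulVec v (s.orderEmbOfFin hs k) = 0 := congrFun hMv k.succ
  rw [hvz, Matrix.mulVec_smul, Pi.smul_apply, smul_eq_mul] at hk
  exact (mul_eq_zero.1 hk).resolve_left hg

/-- Primitive vectors vanishing on the same `n` rows agree up to sign. -/
theorem HasNonzeroMinors.eq_or_eq_neg {m n : ℕ} {A : Matrix (Fin m) (Fin (n + 1)) ℤ}
    (hA : HasNonzeroMinors A) (hnm : n < m) {z w : Fin (n + 1) → ℤ}
    (hz : Finset.univ.gcd z = 1) (hw : Finset.univ.gcd w = 1)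
    (hcard : (zeroRows A w).card = n) (h : zeroRows A w ⊆ zeroRows A z) : z = w ∨ z = -w := by
  obtain ⟨i, hi⟩ : ∃ i, i ∉ zeroRows A w := by
    by_contra! hall
    rw [Finset.eq_univ_of_forall hall, Finset.card_univ, Fintype.card_fin] at hcard
    omega
  set a := A.mulVec w i with ha
  set b := A.mulVec z i with hb
  have ha0 : a ≠ 0 := fun h0 => hi (mem_zeroRows.2 h0)
  have hprop : a • z - b • w = 0 := by
    refine hA.eq_zero (t := insert i (zeroRows A w)) ?_
      (by rw [Finset.card_insert_of_notMem hi, hcard])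
    intro j hj
    rw [mem_zeroRows, Matrix.mulVec_sub, Matrix.mulVec_smul, Matrix.mulVec_smul]
    rcases Finset.mem_insert.1 hj with rfl | hj
    · simp only [Pi.sub_apply, Pi.smul_apply, smul_eq_mul, ← ha, ← hb]
      ring
    · simp [mem_zeroRows.1 hj, mem_zeroRows.1 (h hj)]
  have hab : ∀ j, a * z j = b * w j := fun j => sub_eq_zero.1 (congrFun hprop j)
  have hgcd : normalize a = normalize b := by
    have := Finset.gcd_mul_left (s := Finset.univ) (f := z) (a := a)
    rw [funext hab, Finset.gcd_mul_left, hz, hw, mul_one, mul_one] at this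
    exact this.symm
  have habs : |a| = |b| := by simpa [← Int.abs_eq_normalize] using hgcd
  rcases abs_eq_abs.1 habs with h1 | h1
  · left
    funext j
    exact mul_left_cancel₀ ha0 (by rw [hab, h1])
  · right
    funext j
    refine mul_left_cancel₀ ha0 ?_
    rw [hab, h1, Pi.neg_apply]
    ring

/-- If all maximal minors are nonzero, the primitive circuits are the primitive vectors at which
exactly `n` rows vanish. -/
theorem HasNonzeroMinors.isCircuit_iff {m n : ℕ} {A : Matrix (Fin m) (Fin (n + 1)) ℤ}
    (hA : HasNonzeroMinors A) (hnm : n < m) {z : Fin (n + 1) → ℤ} (hz : Finset.univ.gcd z = 1) :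
    IsCircuit (A.map ((↑) : ℤ → ℝ)) (fun j => (z j : ℝ)) ↔ (zeroRows A z).card = n := by
  have cast_ne_zero : ∀ w : Fin (n + 1) → ℤ, Finset.univ.gcd w = 1 →
      (fun j => (w j : ℝ)) ≠ 0 := fun w hw h =>
    ne_zero_of_gcd_eq_one hw (funext fun j => Int.cast_eq_zero.1 (congrFun h j))
  constructor
  · rintro ⟨-, hmin⟩
    obtain ⟨s, hzs, -, hs⟩ := Finset.exists_subsuperset_card_eq
      (Finset.subset_univ (zeroRows A z)) (hA.card_zeroRows_le (ne_zero_of_gcd_eq_one hz))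
      (by simpa using hnm.le)
    obtain ⟨w, hw, hsw⟩ := exists_primitive_subset_zeroRows A hs
    have heq := hmin _ (cast_ne_zero w hw) fun i hi hzi => hi (by
      rw [mulVec_map_intCast] at hzi ⊢
      exact_mod_cast mem_zeroRows.1 (hsw (hzs (mem_zeroRows.2 (by exact_mod_cast hzi)))))
    have hsz : s ⊆ zeroRows A z := fun i hi => by
      by_contra hzi
      have : i ∈ {i | (A.map ((↑) : ℤ → ℝ)).mulVec (fun j => (w j : ℝ)) i ≠ 0} := by
        rw [heq, Set.mem_ofPred_eq, mulVec_map_intCast]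
        exact_mod_cast fun h => hzi (mem_zeroRows.2 h)
      rw [Set.mem_ofPred_eq, mulVec_map_intCast, mem_zeroRows.1 (hsw hi)] at this
      simp at this
    rw [hzs.antisymm hsz, hs]
  · intro hcard
    refine ⟨cast_ne_zero z hz, fun v hv hsub => hsub.antisymm fun i hi hvi => hi ?_⟩
    classical
    have hle : zeroRows A z ⊆ zeroRows (A.map ((↑) : ℤ → ℝ)) v := fun j hj => by
      rw [mem_zeroRows]
      by_contra hvj
      refine hsub hvj ?_
      rw [mulVec_map_intCast, mem_zeroRows.1 hj, Int.cast_zero]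
    have heq := Finset.eq_of_subset_of_card_le hle
      ((hA.map_intCast.card_zeroRows_le hv).trans hcard.ge)
    have hiz : i ∈ zeroRows A z := heq ▸ mem_zeroRows.2 hvi
    rw [mulVec_map_intCast, mem_zeroRows.1 hiz, Int.cast_zero]

/-- An integer `m × (n + 1)` matrix with nonzero maximal minors has `2 * m.choose n` normalized
circuits. -/
theorem HasNonzeroMinors.ncard_normalized_circuits {m n : ℕ} {A : Matrix (Fin m) (Fin (n + 1)) ℤ}
    (hA : HasNonzeroMinors A) (hnm : n < m) :
    {g : Fin (n + 1) → ℝ | IsCircuit (A.map ((↑) : ℤ → ℝ)) g ∧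
      ∃ z : Fin (n + 1) → ℤ, (∀ i, g i = (z i : ℝ)) ∧ Finset.univ.gcd z = 1}.ncard
      = 2 * m.choose n := by
  have hex : ∀ s : Finset (Fin m), ∃ z : Fin (n + 1) → ℤ, s.card = n →
      Finset.univ.gcd z = 1 ∧ zeroRows A z = s := by
    intro s
    by_cases hs : s.card = n
    · obtain ⟨z, hz, hsz⟩ := exists_primitive_subset_zeroRows A hs
      exact ⟨z, fun _ => ⟨hz, (Finset.eq_of_subset_of_card_le hsz
        ((hA.card_zeroRows_le (ne_zero_of_gcd_eq_one hz)).trans hs.ge)).symm⟩⟩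
    · exact ⟨0, fun h => absurd h hs⟩
  choose c hc using hex
  have zeroRows_neg : ∀ w, zeroRows A (-w) = zeroRows A w := fun w => by
    ext i
    simp [mem_zeroRows, Matrix.mulVec_neg]
  have gcd_neg : ∀ w : Fin (n + 1) → ℤ, Finset.univ.gcd w = 1 → Finset.univ.gcd (-w) = 1 := by
    intro w hw
    have := Finset.gcd_mul_left (s := Finset.univ) (f := w) (a := -1)
    rw [hw] at this
    simpa [Pi.neg_def, ← Int.abs_eq_normalize] using this
  have gcd_smul : ∀ (e : ℤˣ) (w : Fin (n + 1) → ℤ), Finset.univ.gcd w = 1 →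
      Finset.univ.gcd ((e : ℤ) • w) = 1 := fun e w hw => by
    rcases Int.units_eq_one_or e with rfl | rfl
    · simpa using hw
    · simpa using gcd_neg w hw
  have zeroRows_smul : ∀ (e : ℤˣ) (w : Fin (n + 1) → ℤ),
      zeroRows A ((e : ℤ) • w) = zeroRows A w := fun e w => by
    rcases Int.units_eq_one_or e with rfl | rfl
    · simp
    · simpa using zeroRows_neg w
  let T : Finset (Finset (Fin m) × ℤˣ) := Finset.univ.powersetCard n ×ˢ Finset.univ
  let F : Finset (Fin m) × ℤˣ → Fin (n + 1) → ℝ := fun p j => (((p.2 : ℤ) • c p.1) j : ℤ)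
  have hT : ∀ p, p ∈ T ↔ p.1.card = n := fun p => by
    simp [T, Int.units_eq_one_or]
  have hset : {g : Fin (n + 1) → ℝ | IsCircuit (A.map ((↑) : ℤ → ℝ)) g ∧
      ∃ z : Fin (n + 1) → ℤ, (∀ i, g i = (z i : ℝ)) ∧ Finset.univ.gcd z = 1} = F '' T := by
    ext g
    constructor
    · rintro ⟨hg, z, hgz, hz⟩
      obtain rfl : g = fun i => (z i : ℝ) := funext hgz
      have hcard := (hA.isCircuit_iff hnm hz).1 hg
      obtain ⟨hc1, hc0⟩ := hc _ hcard
      rcases hA.eq_or_eq_neg hnm hz hc1 (by rw [hc0, hcard]) hc0.subset with h | h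
      · exact ⟨(zeroRows A z, 1), (hT _).2 hcard, by simp [F, ← h]⟩
      · refine ⟨(zeroRows A z, -1), (hT _).2 hcard, ?_⟩
        funext j
        have := congrFun h j
        rw [this]
        simp [F]
    · rintro ⟨p, hp, rfl⟩
      have hcard := (hT p).1 hp
      obtain ⟨hc1, hc0⟩ := hc _ hcard
      have h1 := gcd_smul p.2 _ hc1
      exact ⟨(hA.isCircuit_iff hnm h1).2 (by rw [zeroRows_smul, hc0, hcard]),
        _, fun _ => rfl, h1⟩
  have hinj : Set.InjOn F T := by
    rintro ⟨s, e⟩ hs ⟨t, e'⟩ ht h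
    have h' : (e : ℤ) • c s = (e' : ℤ) • c t := funext fun j =>
      Int.cast_injective (congrFun h j)
    obtain ⟨hs1, hs0⟩ := hc s ((hT _).1 hs)
    obtain ⟨-, ht0⟩ := hc t ((hT _).1 ht)
    obtain rfl : s = t := by
      rw [← hs0, ← ht0, ← zeroRows_smul e, h', zeroRows_smul]
    obtain ⟨j, hj⟩ := Function.ne_iff.1 (ne_zero_of_gcd_eq_one hs1)
    have he : e = e' := Units.ext (mul_right_cancel₀ hj (congrFun h' j))
    rw [he]
  rw [hset, hinj.ncard_image, Set.ncard_coe_finset]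
  simp [T, mul_comm]

/-- The matrix `A_Q` with integer entries. -/
def AQInt : Matrix (Fin 9) (Fin 4) ℤ :=
  !![3, -3, -1, -2;
     -3, 3, -1, -2;
     -2, 1, -1, -3;
     2, -1, -1, -3;
     -3, -3, 1, -2;
     3, 3, 1, -2;
     1, 2, 1, -3;
     -1, -2, 1, -3;
     0, 0, 0, 2]

theorem AQInt_map_intCast : AQInt.map ((↑) : ℤ → ℝ) = AQ := by
  ext i j
  fin_cases i <;> fin_cases j <;> simp [AQInt, AQ]

theorem hasNonzeroMinors_AQInt : HasNonzeroMinors AQInt := by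
  have key : ∀ i j k l : Fin 9, i < j → j < k → k < l →
      (AQInt.submatrix ![i, j, k, l] id).det ≠ 0 := by
    decide +kernel
  intro f hf
  have hf' : f = ![f 0, f 1, f 2, f 3] := by
    funext i
    fin_cases i <;> rfl
  rw [hf']
  exact key _ _ _ _ (hf (by decide)) (hf (by decide)) (hf (by decide))

/-- The matrix `A_Q` defining the Klee–Walkup polytope realization `Q̃₄` has exactly 84
circuits up to sign: the set of its circuits normalized to coprime integer components has
exactly 168 elements. -/
theorem AQ_has_168_normalized_circuits :
    {g : Fin 4 → ℝ | IsCircuit AQ g ∧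
      ∃ z : Fin 4 → ℤ, (∀ i, g i = (z i : ℝ)) ∧ Finset.univ.gcd z = 1}.ncard = 168 := by
  rw [← AQInt_map_intCast, hasNonzeroMinors_AQInt.ncard_normalized_circuits (by decide)]
  rfl
end
end

section
/- The circuit diameter of the perturbed Klee-Walkup polytope realization Q̃₄′ = {x ∈ ℝ⁴ : C x ≥ b_Q} equals 4: for every ordered pair of vertices u, v of Q̃₄′ there is a circuit walk from u to v of length at most 4, and there exists an ordered pair of vertices admitting no circuit walk of length at most 3. -/
open Matrix

noncomputable section

/-- The constraint matrix of the perturbed Klee–Walkup polytope realization `Q̃₄′`. -/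
def CQ : Matrix (Fin 9) (Fin 4) ℝ :=
  !![3.2, -3, -1, -2;
     -3, 3.2, -1, -2;
     -2, 1, -1, -3;
     2, -1, -1, -3;
     -3, -3, 1.05, -2;
     3, 3, 1.05, -2;
     1.05, 2, 1, -3;
     -1, -2.05, 1, -3;
     0, 0, 0, 2]

namespace KleeWalkup

/-! ### Linear algebra in dimension four -/

section LinearAlgebra

variable {R : Type*} [CommRing R]

/-- The dot product of two vectors of length four. -/
def dot (a x : Fin 4 → R) : R := a 0 * x 0 + a 1 * x 1 + a 2 * x 2 + a 3 * x 3

/-- The `3 × 3` minor of the rows `a, b, c` in the columns `p, q, r`. -/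
def minor (a b c : Fin 4 → R) (p q r : Fin 4) : R :=
  a p * (b q * c r - b r * c q) - a q * (b p * c r - b r * c p) + a r * (b p * c q - b q * c p)

/-- The generalized cross product of three vectors of length four. -/
def cross (a b c : Fin 4 → R) : Fin 4 → R :=
  ![-minor a b c 1 2 3, minor a b c 0 2 3, -minor a b c 0 1 3, minor a b c 0 1 2]

/-- The determinant of the matrix with rows `a, b, c, d`. -/
def det₄ (a b c d : Fin 4 → R) : R := dot d (cross a b c)

/-- The numerators in Cramer's rule for `a ⬝ x = α, b ⬝ x = β, c ⬝ x = γ, d ⬝ x = δ`. -/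
def cramer₄ (a b c d : Fin 4 → R) (α β γ δ : R) (j : Fin 4) : R :=
  δ * cross a b c j - γ * cross a b d j + β * cross a c d j - α * cross b c d j

theorem mul_det₄ (a b c d x : Fin 4 → R) (j : Fin 4) :
    x j * det₄ a b c d = cramer₄ a b c d (dot a x) (dot b x) (dot c x) (dot d x) j := by
  fin_cases j <;> simp [det₄, cramer₄, cross, minor, dot] <;> ring

theorem dot_cross_left (a b c : Fin 4 → R) : dot a (cross a b c) = 0 := by
  simp [dot, cross, minor]; ring

theorem dot_cross_middle (a b c : Fin 4 → R) : dot b (cross a b c) = 0 := by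
  simp [dot, cross, minor]; ring

theorem dot_cross_right (a b c : Fin 4 → R) : dot c (cross a b c) = 0 := by
  simp [dot, cross, minor]; ring

theorem dot_add (a x y : Fin 4 → R) : dot a (x + y) = dot a x + dot a y := by
  simp [dot]; ring

theorem dot_sub (a x y : Fin 4 → R) : dot a (x - y) = dot a x - dot a y := by
  simp [dot]; ring

theorem dot_smul (a x : Fin 4 → R) (t : R) : dot a (t • x) = t * dot a x := by
  simp [dot]; ring

theorem intCast_dot (a x : Fin 4 → ℤ) :
    ((dot a x : ℤ) : R) = dot (fun j => (a j : R)) (fun j => (x j : R)) := by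
  simp [dot]

theorem intCast_cross (a b c : Fin 4 → ℤ) :
    (fun j => ((cross a b c j : ℤ) : R)) =
      cross (fun j => (a j : R)) (fun j => (b j : R)) (fun j => (c j : R)) := by
  ext j
  fin_cases j <;> simp [cross, minor]

theorem intCast_det₄ (a b c d : Fin 4 → ℤ) :
    ((det₄ a b c d : ℤ) : R) = det₄ (fun j => (a j : R)) (fun j => (b j : R))
      (fun j => (c j : R)) (fun j => (d j : R)) := by
  rw [det₄, intCast_dot, intCast_cross, det₄]

theorem intCast_cramer₄ (a b c d : Fin 4 → ℤ) (α β γ δ : ℤ) (j : Fin 4) :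
    ((cramer₄ a b c d α β γ δ j : ℤ) : R) = cramer₄ (fun j => (a j : R)) (fun j => (b j : R))
      (fun j => (c j : R)) (fun j => (d j : R)) α β γ δ j := by
  simp only [cramer₄, Int.cast_add, Int.cast_sub, Int.cast_mul]
  simp only [← intCast_cross]

end LinearAlgebra

theorem exists_lt_lt_of_three_le_card {n : ℕ} {s : Finset (Fin n)} (h : 3 ≤ s.card) :
    ∃ i j k, i < j ∧ j < k ∧ i ∈ s ∧ j ∈ s ∧ k ∈ s := by
  obtain ⟨t, hts, ht⟩ := Finset.exists_subset_card_eq h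
  exact ⟨t.orderEmbOfFin ht 0, t.orderEmbOfFin ht 1, t.orderEmbOfFin ht 2,
    by simp, by simp, hts (t.orderEmbOfFin_mem ht _), hts (t.orderEmbOfFin_mem ht _),
    hts (t.orderEmbOfFin_mem ht _)⟩

theorem exists_lt_lt_lt_of_four_le_card {n : ℕ} {s : Finset (Fin n)} (h : 4 ≤ s.card) :
    ∃ i j k l, i < j ∧ j < k ∧ k < l ∧ i ∈ s ∧ j ∈ s ∧ k ∈ s ∧ l ∈ s := by
  obtain ⟨t, hts, ht⟩ := Finset.exists_subset_card_eq h
  exact ⟨t.orderEmbOfFin ht 0, t.orderEmbOfFin ht 1, t.orderEmbOfFin ht 2,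
    t.orderEmbOfFin ht 3, by simp, by simp, by simp, hts (t.orderEmbOfFin_mem ht _),
    hts (t.orderEmbOfFin_mem ht _), hts (t.orderEmbOfFin_mem ht _),
    hts (t.orderEmbOfFin_mem ht _)⟩

theorem exists_lt_lt_superset_of_card_le_three {s : Finset (Fin 9)} (h : s.card ≤ 3) :
    ∃ i j k, i < j ∧ j < k ∧ ∀ l ∈ s, l = i ∨ l = j ∨ l = k := by
  obtain ⟨t, hst, ht⟩ := Finset.exists_superset_card_eq h (by simp)
  refine ⟨t.orderEmbOfFin ht 0, t.orderEmbOfFin ht 1, t.orderEmbOfFin ht 2,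
    by simp, by simp, fun l hl => ?_⟩
  have : l ∈ Set.range (t.orderEmbOfFin ht) := by
    rw [Finset.range_orderEmbOfFin]; exact hst hl
  obtain ⟨m, rfl⟩ := this
  fin_cases m <;> simp

/-! ### The integer data of the polytope -/

/-- The rows of `CQ`, rescaled to be integral. -/
def row : Fin 9 → Fin 4 → ℤ :=
  ![![16, -15, -5, -10], ![-15, 16, -5, -10], ![-2, 1, -1, -3], ![2, -1, -1, -3],
    ![-60, -60, 21, -40], ![60, 60, 21, -40], ![21, 40, 20, -60], ![-20, -41, 20, -60],
    ![0, 0, 0, 2]]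

/-- The factors by which the rows of `CQ` are rescaled. -/
def offset : Fin 9 → ℤ := ![5, 5, 1, 1, 20, 20, 20, 20, 1]

/-- The change of the `i`-th slack in the direction `g`. -/
def rate (i : Fin 9) (g : Fin 4 → ℝ) : ℝ := dot (fun j => (row i j : ℝ)) g

/-- The rescaled slack of the `i`-th inequality at `x`. -/
def slack (i : Fin 9) (x : Fin 4 → ℝ) : ℝ := rate i x + offset i

theorem offset_mul_mulVec (i : Fin 9) (x : Fin 4 → ℝ) :
    offset i * CQ.mulVec x i = rate i x := by
  fin_cases i <;>
    simp [offset, CQ, rate, dot, row, Matrix.mulVec, dotProduct, Fin.sum_univ_four] <;> ring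

theorem offset_pos (i : Fin 9) : (0 : ℝ) < offset i := by
  have : ∀ i, 0 < offset i := by decide
  exact_mod_cast this i

theorem mulVec_eq_zero_iff (i : Fin 9) (x : Fin 4 → ℝ) : CQ.mulVec x i = 0 ↔ rate i x = 0 := by
  rw [← offset_mul_mulVec, mul_eq_zero, or_iff_right (offset_pos i).ne']

theorem mem_polySet_iff (x : Fin 4 → ℝ) : x ∈ polySet CQ bQ ↔ ∀ i, 0 ≤ slack i x := by
  refine forall_congr' fun i => ?_
  rw [slack, ← offset_mul_mulVec, bQ]
  have := offset_pos i
  constructor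
  · intro h
    nlinarith
  · intro h
    by_contra! h'
    nlinarith

theorem rate_add (i : Fin 9) (x y : Fin 4 → ℝ) : rate i (x + y) = rate i x + rate i y :=
  dot_add ..

theorem rate_sub (i : Fin 9) (x y : Fin 4 → ℝ) : rate i (x - y) = rate i x - rate i y :=
  dot_sub ..

theorem rate_smul (i : Fin 9) (t : ℝ) (x : Fin 4 → ℝ) : rate i (t • x) = t * rate i x :=
  dot_smul ..

theorem slack_add_smul (i : Fin 9) (x g : Fin 4 → ℝ) (t : ℝ) :
    slack i (x + t • g) = slack i x + t * rate i g := by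
  rw [slack, slack, rate_add, rate_smul]; ring

theorem slack_combination (i : Fin 9) (x y : Fin 4 → ℝ) {a b : ℝ} (hab : a + b = 1) :
    slack i (a • x + b • y) = a * slack i x + b * slack i y := by
  simp only [slack, rate_add, rate_smul]
  linear_combination (-(offset i : ℝ)) * hab

theorem rate_sub_eq_zero_iff (i : Fin 9) (x y : Fin 4 → ℝ) :
    rate i (x - y) = 0 ↔ slack i x = slack i y := by
  rw [rate_sub, slack, slack, sub_eq_zero, add_left_inj]

/-- The integral normal direction of the rows `i, j, k`. -/
def normal (i j k : Fin 9) : Fin 4 → ℤ := cross (row i) (row j) (row k)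

/-- The integral rates of all slacks in the direction `normal i j k`. -/
def normalRate (i j k l : Fin 9) : ℤ := dot (row l) (normal i j k)

theorem normalRate_ne_zero : ∀ i j k, i < j → j < k → ∀ l, l ≠ i → l ≠ j → l ≠ k →
    normalRate i j k l ≠ 0 := by
  decide +kernel

theorem exists_ne_ne_ne : ∀ i j k : Fin 9, ∃ l, l ≠ i ∧ l ≠ j ∧ l ≠ k := by
  decide +kernel

theorem rate_normal (i j k l : Fin 9) :
    rate l (fun m => (normal i j k m : ℝ)) = normalRate i j k l := by
  rw [normalRate, intCast_dot, rate]

theorem normalRate_left (i j k : Fin 9) : normalRate i j k i = 0 := dot_cross_left ..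

theorem normalRate_middle (i j k : Fin 9) : normalRate i j k j = 0 := dot_cross_middle ..

theorem normalRate_right (i j k : Fin 9) : normalRate i j k k = 0 := dot_cross_right ..

theorem mul_normalRate (i j k l : Fin 9) (x : Fin 4 → ℝ) (m : Fin 4) :
    x m * normalRate i j k l = cramer₄ (fun j => (row i j : ℝ)) (fun m => (row j m : ℝ))
      (fun m => (row k m : ℝ)) (fun m => (row l m : ℝ))
      (rate i x) (rate j x) (rate k x) (rate l x) m := by
  have := mul_det₄ (fun j => (row i j : ℝ)) (fun m => (row j m : ℝ))
      (fun m => (row k m : ℝ)) (fun m => (row l m : ℝ)) x m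
  rw [← intCast_det₄] at this
  exact this

theorem eq_zero_of_rate_eq_zero {i j k l : Fin 9} (hij : i < j) (hjk : j < k) (hli : l ≠ i)
    (hlj : l ≠ j) (hlk : l ≠ k) {x : Fin 4 → ℝ} (hi : rate i x = 0) (hj : rate j x = 0)
    (hk : rate k x = 0) (hl : rate l x = 0) : x = 0 := by
  ext m
  have h := mul_normalRate i j k l x m
  rw [hi, hj, hk, hl] at h
  have h0 : (normalRate i j k l : ℝ) ≠ 0 := by
    exact_mod_cast normalRate_ne_zero i j k hij hjk l hli hlj hlk
  simpa [cramer₄, h0] using h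

theorem exists_eq_smul_normal {i j k : Fin 9} (hij : i < j) (hjk : j < k) {x : Fin 4 → ℝ}
    (hi : rate i x = 0) (hj : rate j x = 0) (hk : rate k x = 0) :
    ∃ t : ℝ, x = t • fun m => (normal i j k m : ℝ) := by
  obtain ⟨l, hli, hlj, hlk⟩ := exists_ne_ne_ne i j k
  have h0 : (normalRate i j k l : ℝ) ≠ 0 := by
    exact_mod_cast normalRate_ne_zero i j k hij hjk l hli hlj hlk
  refine ⟨rate l x / normalRate i j k l, sub_eq_zero.1 ?_⟩
  apply eq_zero_of_rate_eq_zero hij hjk hli hlj hlk <;>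
    simp [rate_sub, rate_smul, rate_normal, hi, hj, hk, normalRate_left, normalRate_middle,
      normalRate_right, h0]

theorem normal_ne_zero {i j k : Fin 9} (hij : i < j) (hjk : j < k) :
    (fun m => (normal i j k m : ℝ)) ≠ 0 := by
  obtain ⟨l, hli, hlj, hlk⟩ := exists_ne_ne_ne i j k
  intro h
  have h1 := rate_normal i j k l
  rw [h] at h1
  have h0 : (normalRate i j k l : ℝ) ≠ 0 := by
    exact_mod_cast normalRate_ne_zero i j k hij hjk l hli hlj hlk
  exact h0 (by rw [← h1]; simp [rate, dot])

/-! ### Circuits -/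

theorem support_mulVec (g : Fin 4 → ℝ) : {i | CQ.mulVec g i ≠ 0} = {i | rate i g ≠ 0} := by
  ext i
  simp [mulVec_eq_zero_iff]

theorem isCircuit_iff (g : Fin 4 → ℝ) : IsCircuit CQ g ↔
    g ≠ 0 ∧ ∃ i j k, i < j ∧ j < k ∧ rate i g = 0 ∧ rate j g = 0 ∧ rate k g = 0 := by
  simp only [IsCircuit, support_mulVec]
  refine and_congr_right fun hg => ⟨fun h => ?_, ?_⟩
  · by_contra hno
    have hcard : (Finset.univ.filter fun i => rate i g = 0).card ≤ 2 := by
      by_contra! hc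
      obtain ⟨i, j, k, hij, hjk, hi, hj, hk⟩ := exists_lt_lt_of_three_le_card hc
      simp only [Finset.mem_filter, Finset.mem_univ, true_and] at hi hj hk
      exact hno ⟨i, j, k, hij, hjk, hi, hj, hk⟩
    obtain ⟨s, hs⟩ : ∃ s, rate s g ≠ 0 := by
      by_contra! hall
      exact hg (eq_zero_of_rate_eq_zero (i := 0) (j := 1) (k := 2) (l := 3) (by decide)
        (by decide) (by decide) (by decide) (by decide) (hall _) (hall _) (hall _) (hall _))
    obtain ⟨i, j, k, hij, hjk, hsub⟩ := exists_lt_lt_superset_of_card_le_three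
      (s := insert s (Finset.univ.filter fun i => rate i g = 0))
      ((Finset.card_insert_le _ _).trans (by omega))
    have hz : ∀ l, l = i ∨ l = j ∨ l = k → rate l (fun m => (normal i j k m : ℝ)) = 0 := by
      rintro l (rfl | rfl | rfl) <;>
        simp [rate_normal, normalRate_left, normalRate_middle, normalRate_right]
    have heq := h _ (normal_ne_zero hij hjk) fun l hl hl0 =>
      hl (hz l (hsub l (by simp [hl0])))
    have hs' : s ∈ {i | rate i g ≠ 0} := hs
    rw [← heq] at hs'
    exact hs' (hz s (hsub s (by simp)))
  · rintro ⟨i, j, k, hij, hjk, hi, hj, hk⟩ v hv hsub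
    have hz : ∀ l, rate l g = 0 → rate l v = 0 := fun l hl => by
      by_contra hv0
      exact hsub hv0 hl
    obtain ⟨t, rfl⟩ := exists_eq_smul_normal hij hjk hi hj hk
    obtain ⟨r, rfl⟩ := exists_eq_smul_normal hij hjk (hz i hi) (hz j hj) (hz k hk)
    have ht : t ≠ 0 := by rintro rfl; simp at hg
    have hr : r ≠ 0 := by rintro rfl; simp at hv
    ext l
    simp [rate_smul, ht, hr]

theorem isCircuit_sub_iff (x y : Fin 4 → ℝ) : IsCircuit CQ (x - y) ↔
    x ≠ y ∧ ∃ i j k, i < j ∧ j < k ∧ slack i x = slack i y ∧ slack j x = slack j y ∧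
      slack k x = slack k y := by
  simp only [isCircuit_iff, rate_sub_eq_zero_iff, sub_ne_zero]

/-! ### Circuit steps and walks -/

/-- A maximal step from `x` to `y` in a circuit direction. -/
def IsStep (x y : Fin 4 → ℝ) : Prop :=
  ∃ g : Fin 4 → ℝ, ∃ α : ℝ, IsCircuit CQ g ∧ 0 < α ∧ y = x + α • g ∧
    ∀ β : ℝ, α < β → x + β • g ∉ polySet CQ bQ

theorem isCircuitWalk_zero {x : Fin 4 → ℝ} (hx : x ∈ polySet CQ bQ) :
    IsCircuitWalk CQ bQ 0 x x :=
  ⟨fun _ => x, rfl, rfl, fun _ => hx, fun i => i.elim0⟩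

theorem isCircuitWalk_succ_iff {k : ℕ} {x z : Fin 4 → ℝ} : IsCircuitWalk CQ bQ (k + 1) x z ↔
    x ∈ polySet CQ bQ ∧ ∃ y, IsStep x y ∧ IsCircuitWalk CQ bQ k y z := by
  constructor
  · rintro ⟨p, rfl, rfl, hp, hstep⟩
    exact ⟨hp 0, p 1, hstep 0, fun i => p i.succ, rfl, rfl, fun i => hp _,
      fun i => hstep i.succ⟩
  · rintro ⟨hx, y, hxy, p, rfl, rfl, hp, hstep⟩
    refine ⟨Fin.cons x p, rfl, rfl, fun i => ?_, fun i => ?_⟩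
    · induction i using Fin.cases with
      | zero => exact hx
      | succ i => exact hp i
    · induction i using Fin.cases with
      | zero => exact hxy
      | succ i => exact hstep i

theorem IsStep.isCircuit_sub {x y : Fin 4 → ℝ} (h : IsStep x y) : IsCircuit CQ (y - x) := by
  obtain ⟨g, α, hg, hα, rfl, -⟩ := h
  rw [isCircuit_iff] at hg ⊢
  obtain ⟨hg0, i, j, k, hij, hjk, hi, hj, hk⟩ := hg
  refine ⟨by simpa [hα.ne'] using hg0, i, j, k, hij, hjk, ?_, ?_, ?_⟩ <;>
    simp [rate_smul, hi, hj, hk]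

theorem isStep_of_slack {x y : Fin 4 → ℝ} {i j k l : Fin 9} (hij : i < j) (hjk : j < k)
    (hi : slack i y = slack i x) (hj : slack j y = slack j x) (hk : slack k y = slack k x)
    (hx : 0 < slack l x) (hy : slack l y = 0) : IsStep x y := by
  refine ⟨y - x, 1, (isCircuit_sub_iff _ _).2 ⟨?_, i, j, k, hij, hjk, hi, hj, hk⟩, one_pos,
    by simp, fun β hβ hmem => ?_⟩
  · rintro rfl
    exact hx.ne' hy
  · have h := (mem_polySet_iff _).1 hmem l
    have h1 := slack_add_smul l x (y - x) 1
    rw [one_smul, add_sub_cancel, hy] at h1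
    rw [slack_add_smul] at h
    nlinarith

open Filter Topology in
theorem eventually_add_smul_mem {x w : Fin 4 → ℝ} (h : ∀ i, 0 ≤ slack i x)
    (hw : ∀ i, slack i x = 0 → 0 ≤ rate i w) :
    ∀ᶠ ε : ℝ in 𝓝[>] 0, x + ε • w ∈ polySet CQ bQ := by
  simp only [mem_polySet_iff, slack_add_smul, eventually_all]
  intro i
  rcases (h i).eq_or_lt with h0 | hpos
  · filter_upwards [self_mem_nhdsWithin] with ε hε
    rw [← h0, zero_add]
    exact mul_nonneg (le_of_lt hε) (hw i h0.symm)
  · have hc : Continuous fun ε : ℝ => slack i x + ε * rate i w := by fun_prop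
    have := (hc.tendsto 0).eventually (lt_mem_nhds (a := 0) (by simpa using hpos))
    filter_upwards [nhdsWithin_le_nhds this] with ε hε using hε.le

open Filter Topology in
theorem exists_blocking {x g : Fin 4 → ℝ} {α : ℝ} (hmem : x + α • g ∈ polySet CQ bQ)
    (hmax : ∀ β : ℝ, α < β → x + β • g ∉ polySet CQ bQ) :
    ∃ i, rate i g < 0 ∧ slack i x + α * rate i g = 0 := by
  by_contra! hno
  have hev := eventually_add_smul_mem (w := g) ((mem_polySet_iff _).1 hmem) fun i hi => by
    by_contra! hneg
    exact hno i hneg (by rwa [slack_add_smul] at hi)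
  obtain ⟨ε, hε, hpos⟩ := (hev.and self_mem_nhdsWithin).exists
  refine hmax (α + ε) (by simpa using hpos) ?_
  rwa [add_smul, ← add_assoc]

/-! ### Vertices -/

theorem four_tight_of_mem_extremePoints {x : Fin 4 → ℝ}
    (hx : x ∈ Set.extremePoints ℝ (polySet CQ bQ)) :
    ∃ i j k l, i < j ∧ j < k ∧ k < l ∧
      slack i x = 0 ∧ slack j x = 0 ∧ slack k x = 0 ∧ slack l x = 0 := by
  by_contra hno
  have hcard : (Finset.univ.filter fun i => slack i x = 0).card ≤ 3 := by
    by_contra! hc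
    obtain ⟨i, j, k, l, hij, hjk, hkl, hi, hj, hk, hl⟩ := exists_lt_lt_lt_of_four_le_card hc
    simp only [Finset.mem_filter, Finset.mem_univ, true_and] at hi hj hk hl
    exact hno ⟨i, j, k, l, hij, hjk, hkl, hi, hj, hk, hl⟩
  obtain ⟨i, j, k, hij, hjk, hsub⟩ := exists_lt_lt_superset_of_card_le_three hcard
  set w : Fin 4 → ℝ := fun m => (normal i j k m : ℝ) with hwdef
  have hw : ∀ l, slack l x = 0 → rate l w = 0 := fun l hl => by
    rcases hsub l (by simpa using hl) with rfl | rfl | rfl <;>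
      simp [hwdef, rate_normal, normalRate_left, normalRate_middle, normalRate_right]
  have hmem := (mem_polySet_iff x).1 hx.1
  have h1 := eventually_add_smul_mem hmem fun l hl => (hw l hl).ge
  have h2 := eventually_add_smul_mem (w := -w) hmem fun l hl => by
    rw [← neg_one_smul ℝ w, rate_smul, hw l hl, mul_zero]
  obtain ⟨ε, ⟨hε1, hε2⟩, hpos⟩ := ((h1.and h2).and self_mem_nhdsWithin).exists
  have hmid : x ∈ openSegment ℝ (x + ε • w) (x + ε • -w) :=
    ⟨1 / 2, 1 / 2, by norm_num, by norm_num, by norm_num, by module⟩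
  have heq := hx.2 hε1 hε2 hmid
  have hpos' : ε ≠ 0 := (show (0 : ℝ) < ε from hpos).ne'
  simp only [add_eq_left, smul_eq_zero, hpos', false_or] at heq
  exact normal_ne_zero hij hjk heq

theorem mem_extremePoints_of_tight {x : Fin 4 → ℝ} (hx : x ∈ polySet CQ bQ) {i j k l : Fin 9}
    (hij : i < j) (hjk : j < k) (hkl : k < l) (hi : slack i x = 0) (hj : slack j x = 0)
    (hk : slack k x = 0) (hl : slack l x = 0) :
    x ∈ Set.extremePoints ℝ (polySet CQ bQ) := by
  refine ⟨hx, fun y hy z hz hseg => ?_⟩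
  obtain ⟨a, b, ha, hb, hab, rfl⟩ := hseg
  have key : ∀ m, slack m (a • y + b • z) = 0 → rate m (y - (a • y + b • z)) = 0 := fun m hm => by
    have hym := (mem_polySet_iff y).1 hy m
    have hzm := (mem_polySet_iff z).1 hz m
    rw [rate_sub_eq_zero_iff, hm]
    rw [slack_combination m y z hab, add_eq_zero_iff_of_nonneg (mul_nonneg ha.le hym)
      (mul_nonneg hb.le hzm)] at hm
    exact (mul_eq_zero.1 hm.1).resolve_left ha.ne'
  exact sub_eq_zero.1 (eq_zero_of_rate_eq_zero hij hjk (hij.trans (hjk.trans hkl)).ne'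
    (hjk.trans hkl).ne' hkl.ne' (key i hi) (key j hj) (key k hk) (key l hl))

/-- A rational point in homogeneous coordinates. -/
structure HPoint where
  den : ℤ
  num : Fin 4 → ℤ

/-- The real point with given homogeneous coordinates. -/
def HPoint.toReal (p : HPoint) : Fin 4 → ℝ := fun m => p.num m / p.den

/-- The slack at a rational point, multiplied by its denominator. -/
def HPoint.slack (p : HPoint) (i : Fin 9) : ℤ := dot (row i) p.num + offset i * p.den

theorem HPoint.slack_toReal (p : HPoint) (hp : p.den ≠ 0) (i : Fin 9) :
    KleeWalkup.slack i p.toReal = p.slack i / p.den := by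
  have : (p.den : ℝ) ≠ 0 := by exact_mod_cast hp
  simp only [KleeWalkup.slack, rate, HPoint.slack, toReal, dot]
  push_cast
  field_simp

/-- The intersection point of the hyperplanes bounding the inequalities `i, j, k, l`. -/
def basicPoint (i j k l : Fin 9) : HPoint where
  den := normalRate i j k l
  num := cramer₄ (row i) (row j) (row k) (row l) (-offset i) (-offset j) (-offset k) (-offset l)

theorem eq_basicPoint {i j k l : Fin 9} (hij : i < j) (hjk : j < k) (hkl : k < l)
    {x : Fin 4 → ℝ} (hi : slack i x = 0) (hj : slack j x = 0) (hk : slack k x = 0)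
    (hl : slack l x = 0) : x = (basicPoint i j k l).toReal := by
  have h0 : (normalRate i j k l : ℝ) ≠ 0 := by
    exact_mod_cast normalRate_ne_zero i j k hij hjk l (hij.trans (hjk.trans hkl)).ne'
      (hjk.trans hkl).ne' hkl.ne'
  ext m
  have h := mul_normalRate i j k l x m
  rw [slack, add_eq_zero_iff_eq_neg] at hi hj hk hl
  rw [hi, hj, hk, hl] at h
  simp only [HPoint.toReal, basicPoint]
  rw [eq_div_iff h0, h, intCast_cramer₄]
  push_cast
  rfl

/-- The 27 vertices of the polytope, followed by two further points visited by circuit walks. -/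
def waypointTable : List HPoint :=
  [⟨1, ![0, 0, 1, 0]⟩,
   ⟨12, ![5, 5, 25, -6]⟩,
   ⟨8, ![-5, -5, 15, -4]⟩,
   ⟨2342, ![205, 410, 620, 574]⟩,
   ⟨6108, ![3895, 4300, 11780, -3054]⟩,
   ⟨76412, ![4305, 12500, 13020, 19834]⟩,
   ⟨15397, ![-2340, 619, -2040, 4046]⟩,
   ⟨2508, ![-1655, -1620, 4580, -1254]⟩,
   ⟨25625, ![-3240, 1640, -3999, 7168]⟩,
   ⟨5856, ![-3485, 3700, -10540, -2928]⟩,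
   ⟨410810, ![-66420, 33620, -104880, 101143]⟩,
   ⟨15894, ![-10015, 9800, -29660, -7947]⟩,
   ⟨2651, ![-205, -410, 560, 697]⟩,
   ⟨16047, ![2459, -820, -2480, 4263]⟩,
   ⟨2634, ![1840, 1435, 4340, -1317]⟩,
   ⟨76082, ![-4900, -11495, 13220, 20389]⟩,
   ⟨24543, ![3240, -1640, -4121, 6848]⟩,
   ⟨6234, ![-4080, -4115, 11540, -3117]⟩,
   ⟨10174, ![1620, -820, -2480, 2585]⟩,
   ⟨31278, ![19700, -19680, -59520, -15639]⟩,
   ⟨11622, ![7300, -7320, -22080, -5811]⟩,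
   ⟨5547, ![400, 800, 1020, 1509]⟩,
   ⟨11197, ![-800, -1600, 2020, 3059]⟩,
   ⟨3, ![0, 0, 0, 1]⟩,
   ⟨23, ![0, 0, -20, 1]⟩,
   ⟨798, ![500, -500, -1520, -399]⟩,
   ⟨882, ![-500, 500, -1680, -441]⟩,
   ⟨1317, ![451, 205, 620, 0]⟩,
   ⟨80235, ![28690, 28690, 154829, -34428]⟩]

/-- The points that can be reached by one circuit step along an edge, or by a step of one of the
two walks joining the vertices at combinatorial distance five. -/
def successorTable : List (List ℕ) :=
  [[1, 2, 3, 12, 27],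
   [0, 2, 4, 14],
   [0, 1, 7, 17],
   [0, 4, 5, 21],
   [1, 3, 9, 14],
   [3, 8, 9, 21],
   [7, 8, 10, 22],
   [2, 6, 11, 17],
   [5, 6, 10, 23],
   [4, 5, 11, 26],
   [6, 8, 11, 24],
   [7, 9, 10, 26],
   [0, 15, 17, 22],
   [14, 16, 18, 21, 28],
   [1, 4, 13, 19],
   [12, 16, 20, 22],
   [13, 15, 18, 23],
   [2, 7, 12, 20],
   [13, 16, 19, 24],
   [14, 18, 20, 25],
   [15, 17, 19, 25],
   [3, 5, 13, 23],
   [6, 12, 15, 23],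
   [8, 16, 21, 22],
   [10, 18, 25, 26],
   [19, 20, 24, 26],
   [9, 11, 24, 25],
   [13],
   [0]]

/-- The `n`-th point of the table. -/
def waypoint (n : ℕ) : HPoint := waypointTable.getD n ⟨1, 0⟩

theorem basicPoint_feasible : ∀ i j k l : Fin 9, i < j → j < k → k < l →
    (∃ m, (basicPoint i j k l).slack m * (basicPoint i j k l).den < 0) ∨
      ∃ n ∈ List.range 27, ∀ m, (waypoint n).num m * (basicPoint i j k l).den =
        (basicPoint i j k l).num m * (waypoint n).den := by
  decide +kernel

theorem waypoint_den_pos (n : ℕ) : 0 < (waypoint n).den := by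
  have h : ∀ p ∈ waypointTable, 0 < p.den := by decide +kernel
  rw [waypoint, List.getD_eq_getElem?_getD]
  rcases hn : waypointTable[n]? with _ | p
  · simp
  · exact h p (List.mem_of_getElem? hn)

theorem waypoint_feasible : ∀ n ∈ List.range 29, ∀ i, 0 ≤ (waypoint n).slack i := by
  decide +kernel

theorem waypoint_mem {n : ℕ} (hn : n < 29) : (waypoint n).toReal ∈ polySet CQ bQ := by
  refine (mem_polySet_iff _).2 fun i => ?_
  rw [HPoint.slack_toReal _ (waypoint_den_pos n).ne']
  have h1 : (0 : ℝ) ≤ (waypoint n).slack i := by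
    exact_mod_cast waypoint_feasible n (List.mem_range.2 hn) i
  have h2 : (0 : ℝ) < (waypoint n).den := by exact_mod_cast waypoint_den_pos n
  positivity

theorem exists_waypoint_of_mem_extremePoints {x : Fin 4 → ℝ}
    (hx : x ∈ Set.extremePoints ℝ (polySet CQ bQ)) :
    ∃ n < 27, x = (waypoint n).toReal := by
  obtain ⟨i, j, k, l, hij, hjk, hkl, hi, hj, hk, hl⟩ := four_tight_of_mem_extremePoints hx
  have hxb := eq_basicPoint hij hjk hkl hi hj hk hl
  have h0 : (basicPoint i j k l).den ≠ 0 :=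
    normalRate_ne_zero i j k hij hjk l (hij.trans (hjk.trans hkl)).ne'
      (hjk.trans hkl).ne' hkl.ne'
  rcases basicPoint_feasible i j k l hij hjk hkl with ⟨m, hm⟩ | ⟨n, hn, hm⟩
  · exfalso
    have h := (mem_polySet_iff x).1 hx.1 m
    rw [hxb, HPoint.slack_toReal _ h0] at h
    have hm' : ((basicPoint i j k l).slack m : ℝ) * (basicPoint i j k l).den < 0 := by
      exact_mod_cast hm
    rcases div_nonneg_iff.1 h with ⟨h1, h2⟩ | ⟨h1, h2⟩ <;> nlinarith
  · refine ⟨n, List.mem_range.1 hn, ?_⟩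
    rw [hxb]
    ext m
    have h1 : ((basicPoint i j k l).den : ℝ) ≠ 0 := by exact_mod_cast h0
    have h2 : ((waypoint n).den : ℝ) ≠ 0 := by exact_mod_cast (waypoint_den_pos n).ne'
    rw [HPoint.toReal, HPoint.toReal, div_eq_div_iff h1 h2]
    exact_mod_cast (hm m).symm

/-! ### Short walks between all vertices -/

theorem three_le_card_of_successor : ∀ n ∈ List.range 29, ∀ m ∈ successorTable.getD n [],
    m < 29 ∧ 3 ≤ (Finset.univ.filter fun i => (waypoint m).slack i * (waypoint n).den =
        (waypoint n).slack i * (waypoint m).den).card ∧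
      ∃ i, 0 < (waypoint n).slack i ∧ (waypoint m).slack i = 0 := by
  decide +kernel

theorem isStep_of_successor {n m : ℕ} (hn : n < 29) (hm : m ∈ successorTable.getD n []) :
    m < 29 ∧ IsStep (waypoint n).toReal (waypoint m).toReal := by
  obtain ⟨hm29, hcard, l, hl, hl0⟩ := three_le_card_of_successor n (List.mem_range.2 hn) m hm
  obtain ⟨i, j, k, hij, hjk, hi, hj, hk⟩ := exists_lt_lt_of_three_le_card hcard
  simp only [Finset.mem_filter, Finset.mem_univ, true_and] at hi hj hk
  have h1 : ((waypoint n).den : ℝ) ≠ 0 := by exact_mod_cast (waypoint_den_pos n).ne'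
  have h2 : ((waypoint m).den : ℝ) ≠ 0 := by exact_mod_cast (waypoint_den_pos m).ne'
  have heq : ∀ i, (waypoint m).slack i * (waypoint n).den =
      (waypoint n).slack i * (waypoint m).den →
      slack i (waypoint m).toReal = slack i (waypoint n).toReal := fun i h => by
    rw [HPoint.slack_toReal _ (waypoint_den_pos m).ne',
      HPoint.slack_toReal _ (waypoint_den_pos n).ne', div_eq_div_iff h2 h1]
    exact_mod_cast h
  refine ⟨hm29, isStep_of_slack (l := l) hij hjk (heq i hi) (heq j hj) (heq k hk) ?_ ?_⟩
  · rw [HPoint.slack_toReal _ (waypoint_den_pos n).ne']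
    have := waypoint_den_pos n
    positivity
  · rw [HPoint.slack_toReal _ (waypoint_den_pos m).ne', hl0]
    simp

/-- Whether the `m`-th point can be reached from the `n`-th one by at most `k` tabulated steps. -/
def reaches : ℕ → ℕ → ℕ → Bool
  | 0, n, m => n == m
  | k + 1, n, m => n == m || (successorTable.getD n []).any fun l => reaches k l m

theorem exists_walk_of_reaches {k n m : ℕ} (hn : n < 29) (h : reaches k n m = true) :
    ∃ r ≤ k, IsCircuitWalk CQ bQ r (waypoint n).toReal (waypoint m).toReal := by
  induction k generalizing n with
  | zero =>
    obtain rfl : n = m := by simpa [reaches] using h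
    exact ⟨0, le_rfl, isCircuitWalk_zero (waypoint_mem hn)⟩
  | succ k ih =>
    rw [reaches, Bool.or_eq_true, beq_iff_eq, List.any_eq_true] at h
    rcases h with rfl | ⟨l, hl, hlm⟩
    · exact ⟨0, by omega, isCircuitWalk_zero (waypoint_mem hn)⟩
    · obtain ⟨hl29, hstep⟩ := isStep_of_successor hn hl
      obtain ⟨r, hr, hwalk⟩ := ih hl29 hlm
      exact ⟨r + 1, by omega, isCircuitWalk_succ_iff.2 ⟨waypoint_mem hn, _, hstep, hwalk⟩⟩

theorem reaches_four : ∀ n ∈ List.range 27, ∀ m ∈ List.range 27, reaches 4 n m = true := by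
  decide +kernel

/-! ### The absence of walks of length three -/

/-- The vectors of slack rates of all circuits, up to scaling. -/
def circuitRates : List (Fin 9 → ℤ) :=
  ((List.finRange 9).product ((List.finRange 9).product (List.finRange 9))).filterMap fun t =>
    if t.1 < t.2.1 ∧ t.2.1 < t.2.2 then some (normalRate t.1 t.2.1 t.2.2) else none

theorem normalRate_mem_circuitRates {i j k : Fin 9} (hij : i < j) (hjk : j < k) :
    normalRate i j k ∈ circuitRates := by
  rw [circuitRates, List.mem_filterMap]
  exact ⟨(i, j, k), by simp [List.product], by simp [hij, hjk]⟩

/-- If the slacks `s / D` change at the rates `d` until the `i`-th one vanishes, the resulting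
slacks are `advance s d i / (D * -d i)`. -/
def advance (s d : Fin 9 → ℤ) (i l : Fin 9) : ℤ := s l * -d i + s i * d l

/-- A sufficient criterion, by exhaustive search, for the absence of walks of length at most
`k + 1` from the point with slacks `s / D` to the point with slacks `t / E`. -/
def avoids (E : ℤ) (t : Fin 9 → ℤ) : ℕ → ℤ → (Fin 9 → ℤ) → Bool
  | 0, D, s => decide ((Finset.univ.filter fun l => t l * D = s l * E).card ≤ 2)
  | k + 1, D, s => decide ((Finset.univ.filter fun l => t l * D = s l * E).card ≤ 2) &&
      circuitRates.all fun c => [c, fun l => -c l].all fun d =>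
        (List.finRange 9).any (fun i => decide (s i = 0) && decide (d i < 0)) ||
          (List.finRange 9).all fun i => decide (s i = 0) || !decide (d i < 0) ||
            (List.finRange 9).any (fun l => decide (advance s d i l < 0)) ||
            avoids E t k (D * -d i) (advance s d i)

theorem avoids_card {E D : ℤ} {t s : Fin 9 → ℤ} {k : ℕ} (h : avoids E t k D s = true) :
    (Finset.univ.filter fun l => t l * D = s l * E).card ≤ 2 := by
  cases k <;> simp_all [avoids]

theorem exists_advance {x y : Fin 4 → ℝ} (hxy : IsStep x y)
    (hy : y ∈ polySet CQ bQ) {D : ℤ} {s : Fin 9 → ℤ} (hD : 0 < D) (hs : ∀ l, D * slack l x = s l) :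
    ∃ c ∈ circuitRates, ∃ d ∈ [c, fun l => -c l], ∃ i, d i < 0 ∧ 0 < s i ∧
      (∀ l, 0 ≤ advance s d i l) ∧
      ∀ l, ((D * -d i : ℤ) : ℝ) * slack l y = advance s d i l := by
  obtain ⟨g, α, hg, hα, rfl, hmax⟩ := hxy
  obtain ⟨hg0, a, b, c, hab, hbc, ha, hb, hc⟩ := (isCircuit_iff g).1 hg
  obtain ⟨τ, rfl⟩ := exists_eq_smul_normal hab hbc ha hb hc
  have hτ : τ ≠ 0 := by rintro rfl; simp at hg0
  obtain ⟨d, hd, r, hr, hrate⟩ : ∃ d ∈ [normalRate a b c, fun l => -normalRate a b c l],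
      ∃ r : ℝ, 0 < r ∧ ∀ l, rate l (τ • fun m => (normal a b c m : ℝ)) = r * d l := by
    rcases hτ.lt_or_gt with h | h
    · exact ⟨fun l => -normalRate a b c l, by simp, -τ, by linarith, fun l => by
        simp [rate_smul, rate_normal]⟩
    · exact ⟨normalRate a b c, by simp, τ, h, fun l => by simp [rate_smul, rate_normal]⟩
  obtain ⟨i, hneg, hzero⟩ := exists_blocking hy hmax
  rw [hrate] at hneg hzero
  have hdi : (d i : ℝ) < 0 := by
    by_contra! h
    nlinarith
  have hDr : (0 : ℝ) < D := by exact_mod_cast hD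
  have hnext : ∀ l, ((D * -d i : ℤ) : ℝ) * slack l (x + α • τ • fun m => (normal a b c m : ℝ)) =
      advance s d i l := fun l => by
    rw [slack_add_smul, hrate, advance]
    push_cast
    rw [← hs l, ← hs i]
    linear_combination (-(D : ℝ) * d l) * hzero
  refine ⟨_, normalRate_mem_circuitRates hab hbc, d, hd, i, by exact_mod_cast hdi, ?_,
    fun l => ?_, hnext⟩
  · have : (0 : ℝ) < s i := by
      rw [← hs i]
      have : 0 < α * (r * -d i) := by
        have : (0 : ℝ) < -d i := by linarith
        positivity
      exact mul_pos hDr (by linarith)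
    exact_mod_cast this
  · have h1 : (0 : ℝ) ≤ advance s d i l := by
      rw [← hnext l]
      push_cast
      exact mul_nonneg (mul_nonneg hDr.le (by linarith)) ((mem_polySet_iff _).1 hy l)
    exact_mod_cast h1

theorem not_isStep_of_card {x z : Fin 4 → ℝ} {D E : ℤ} {s t : Fin 9 → ℤ}
    (hs : ∀ l, D * slack l x = s l) (ht : ∀ l, E * slack l z = t l)
    (hcard : (Finset.univ.filter fun l => t l * D = s l * E).card ≤ 2) :
    x ≠ z ∧ ¬ IsStep x z := by
  have hagree : ∀ l, slack l z = slack l x → t l * D = s l * E := fun l hl => by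
    have : (t l : ℝ) * D = s l * E := by rw [← ht, ← hs, hl]; ring
    exact_mod_cast this
  have hfew : ∀ i j k, i < j → j < k → slack i z = slack i x → slack j z = slack j x →
      slack k z = slack k x → False := fun i j k hij hjk hi hj hk => by
    have h3 : ({i, j, k} : Finset (Fin 9)).card = 3 := Finset.card_eq_three.2
      ⟨i, j, k, hij.ne, (hij.trans hjk).ne, hjk.ne, rfl⟩
    have hle : ({i, j, k} : Finset (Fin 9)).card ≤
        (Finset.univ.filter fun l => t l * D = s l * E).card := Finset.card_le_card fun l hl => by
      simp only [Finset.mem_insert, Finset.mem_singleton] at hl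
      rcases hl with rfl | rfl | rfl <;> simp [hagree, hi, hj, hk]
    omega
  refine ⟨?_, fun hxz => ?_⟩
  · rintro rfl
    exact hfew 0 1 2 (by decide) (by decide) rfl rfl rfl
  · obtain ⟨-, i, j, k, hij, hjk, hi, hj, hk⟩ := (isCircuit_sub_iff _ _).1 hxz.isCircuit_sub
    exact hfew i j k hij hjk hi hj hk

theorem IsCircuitWalk.mem {k : ℕ} {x z : Fin 4 → ℝ} (h : IsCircuitWalk CQ bQ k x z) :
    x ∈ polySet CQ bQ := by
  obtain ⟨p, rfl, -, hp, -⟩ := h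
  exact hp 0

theorem not_isCircuitWalk_of_avoids {z : Fin 4 → ℝ} {E : ℤ} {t : Fin 9 → ℤ}
    (ht : ∀ l, E * slack l z = t l) {k : ℕ} {D : ℤ} {s : Fin 9 → ℤ} {x : Fin 4 → ℝ}
    (h : avoids E t k D s = true) (hD : 0 < D) (hs : ∀ l, D * slack l x = s l) :
    ∀ r ≤ k + 1, ¬ IsCircuitWalk CQ bQ r x z := by
  induction k generalizing D s x with
  | zero =>
    obtain ⟨hne, hstep⟩ := not_isStep_of_card hs ht (avoids_card h)
    intro r hr hwalk
    obtain rfl | rfl : r = 0 ∨ r = 1 := by omega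
    · obtain ⟨p, rfl, rfl, -⟩ := hwalk
      exact hne rfl
    · obtain ⟨-, y, hxy, p, rfl, rfl, -⟩ := isCircuitWalk_succ_iff.1 hwalk
      exact hstep hxy
  | succ k ih =>
    intro r hr hwalk
    rcases r with _ | r
    · obtain ⟨p, rfl, rfl, -⟩ := hwalk
      exact (not_isStep_of_card hs ht (avoids_card h)).1 rfl
    · obtain ⟨-, y, hxy, hwalk⟩ := isCircuitWalk_succ_iff.1 hwalk
      obtain ⟨c, hc, d, hd, i, hdi, hsi, hnonneg, hnext⟩ :=
        exists_advance hxy (IsCircuitWalk.mem hwalk) hD hs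
      rw [avoids, Bool.and_eq_true, List.all_eq_true] at h
      have h1 := List.all_eq_true.1 (h.2 c hc) d hd
      have hleave : (List.finRange 9).any (fun l => decide (s l = 0) && decide (d l < 0)) =
          false := by
        simp only [List.any_eq_false, Bool.and_eq_true, decide_eq_true_eq, not_and, not_lt]
        intro l _ hl
        have := hnonneg l
        rw [advance, hl, zero_mul, zero_add] at this
        exact nonneg_of_mul_nonneg_right this hsi
      have hfeas : (List.finRange 9).any (fun l => decide (advance s d i l < 0)) = false := by
        simpa using hnonneg
      rw [hleave, Bool.false_or, List.all_eq_true] at h1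
      have h2 := h1 i (List.mem_finRange i)
      simp only [hdi, hsi.ne', hfeas, decide_true, decide_false, Bool.not_true,
        Bool.false_or] at h2
      exact ih h2 (mul_pos hD (by omega)) hnext r (by omega) hwalk

theorem avoids_two : avoids 23 (waypoint 24).slack 2 1 (waypoint 0).slack = true := by
  decide +kernel

theorem waypoint_mem_extremePoints {n : ℕ} (hn : n < 29) {i j k l : Fin 9}
    (hij : i < j) (hjk : j < k) (hkl : k < l) (hi : (waypoint n).slack i = 0)
    (hj : (waypoint n).slack j = 0) (hk : (waypoint n).slack k = 0)
    (hl : (waypoint n).slack l = 0) :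
    (waypoint n).toReal ∈ Set.extremePoints ℝ (polySet CQ bQ) := by
  refine mem_extremePoints_of_tight (waypoint_mem hn) hij hjk hkl ?_ ?_ ?_ ?_ <;>
    simp [HPoint.slack_toReal _ (waypoint_den_pos n).ne', *]

theorem den_mul_slack_waypoint (n : ℕ) (l : Fin 9) :
    ((waypoint n).den : ℝ) * slack l (waypoint n).toReal = (waypoint n).slack l := by
  have : ((waypoint n).den : ℝ) ≠ 0 := by exact_mod_cast (waypoint_den_pos n).ne'
  rw [HPoint.slack_toReal _ (waypoint_den_pos n).ne']
  field_simp

end KleeWalkup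

/-- The circuit diameter of the perturbed Klee–Walkup polytope realization
`Q̃₄′ = {x ∈ ℝ⁴ : C x ≥ b_Q}` equals 4: every ordered pair of vertices is joined by a circuit
walk of length at most 4, and some ordered pair of vertices admits no circuit walk of length
at most 3. -/
theorem Q4_perturbed_circuit_diameter_eq_four :
    (∀ u v : Fin 4 → ℝ, u ∈ Set.extremePoints ℝ (polySet CQ bQ) →
      v ∈ Set.extremePoints ℝ (polySet CQ bQ) →
      ∃ k ≤ 4, IsCircuitWalk CQ bQ k u v) ∧
    (∃ u v : Fin 4 → ℝ, u ∈ Set.extremePoints ℝ (polySet CQ bQ) ∧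
      v ∈ Set.extremePoints ℝ (polySet CQ bQ) ∧
      ∀ k ≤ 3, ¬ IsCircuitWalk CQ bQ k u v) := by
  open KleeWalkup in
  refine ⟨fun u v hu hv => ?_, (waypoint 0).toReal, (waypoint 24).toReal, ?_, ?_, ?_⟩
  · obtain ⟨n, hn, rfl⟩ := exists_waypoint_of_mem_extremePoints hu
    obtain ⟨m, hm, rfl⟩ := exists_waypoint_of_mem_extremePoints hv
    exact exists_walk_of_reaches (by omega)
      (reaches_four n (List.mem_range.2 hn) m (List.mem_range.2 hm))
  · exact waypoint_mem_extremePoints (i := 0) (j := 1) (k := 2) (l := 3) (by decide) (by decide)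
      (by decide) (by decide) (by decide +kernel) (by decide +kernel) (by decide +kernel)
      (by decide +kernel)
  · exact waypoint_mem_extremePoints (i := 4) (j := 5) (k := 6) (l := 7) (by decide) (by decide)
      (by decide) (by decide) (by decide +kernel) (by decide +kernel) (by decide +kernel)
      (by decide +kernel)
  · exact not_isCircuitWalk_of_avoids (den_mul_slack_waypoint 24) avoids_two
      (waypoint_den_pos 0) (den_mul_slack_waypoint 0)
end
end
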